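/- arXiv:2001.05557 — 4 statements merged into one kernel-verified Lean document; each statement's English description precedes it below -/
import Mathlib

section
/- Let (a,b,c) be a Markoff triple of reals, T a trace function for (a,b,c), and F as defined. Then there is a (unique) continuous function G : [0,1] → ℝ with G(p/q) = F(p/q) for every rational p/q ∈ [0,1]; G is convex, and G is differentiable at every irrational point x ∈ (0,1). -/
/-- A vector of `ℤ²` is primitive if its coordinates are coprime. -/
def Primitive (v : ℤ × ℤ) : Prop := IsCoprime v.1 v.2

/-- A trace function for a triple `(a,b,c)` of reals: a function on `ℤ²` satisfying
`T(−v) = T(v)` for primitive `v`, with `T(0,1) = a`, `T(1,1) = b`, `T(1,0) = c`, and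
`T(v+w) = T(v)·T(w) − T(v−w)` whenever `v, w` are primitive with `det(v,w) = ±1`. -/
structure IsTraceFunction (a b c : ℝ) (T : ℤ × ℤ → ℝ) : Prop where
  neg_eq : ∀ v : ℤ × ℤ, Primitive v → T (-v) = T v
  map_01 : T (0, 1) = a
  map_11 : T (1, 1) = b
  map_10 : T (1, 0) = c
  add_rule : ∀ v w : ℤ × ℤ, Primitive v → Primitive w →
    (v.1 * w.2 - v.2 * w.1 = 1 ∨ v.1 * w.2 - v.2 * w.1 = -1) →
    T (v + w) = T v * T w - T (v - w)

/-- The hyperbolic length associated to a trace `t`: `l = 2·log((t + √(t²−4))/2)`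
(so that `t = 2·cosh(l/2)` when `t > 2`). -/
noncomputable def traceLength (t : ℝ) : ℝ := 2 * Real.log ((t + Real.sqrt (t ^ 2 - 4)) / 2)

/-- For a rational `r = p/q` in lowest terms (`q ≥ 1`), `F(r) = l(p/q)/q` where
`l(p/q) = 2·log((t+√(t²−4))/2)` and `t = T(p,q)`. -/
noncomputable def Ffun (T : ℤ × ℤ → ℝ) (r : ℚ) : ℝ :=
  traceLength (T (r.num, (r.den : ℤ))) / (r.den : ℝ)

/-- The determinant of the matrix with columns `v` and `w`. -/
def cross (v w : ℤ × ℤ) : ℤ := v.1 * w.2 - v.2 * w.1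

section

open Matrix MatrixGroups in
/-- Every integer basis of determinant one arises from the standard one by elementary moves. -/
theorem basis_induction {P : ℤ × ℤ → ℤ × ℤ → Prop} (base : P (1, 0) (0, 1))
    (hswap : ∀ v w, cross v w = 1 → P v w → P w (-v))
    (hadd : ∀ v w, cross v w = 1 → P v w → P v (v + w))
    {v w : ℤ × ℤ} (h : cross v w = 1) : P v w := by
  let Q (v w : ℤ × ℤ) : Prop := cross v w = 1 ∧ P v w
  have swapQ {v w} (hQ : Q v w) : Q w (-v) :=
    ⟨by rw [← hQ.1]; simp only [cross, Prod.fst_neg, Prod.snd_neg]; ring, hswap _ _ hQ.1 hQ.2⟩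
  have addQ {v w} (hQ : Q v w) : Q v (v + w) :=
    ⟨by rw [← hQ.1]; simp only [cross, Prod.fst_add, Prod.snd_add]; ring, hadd _ _ hQ.1 hQ.2⟩
  have key : ∀ g : SL(2, ℤ), Q (g 0 0, g 1 0) (g 0 1, g 1 1) := by
    intro g
    have hg : g ∈ Subgroup.closure {ModularGroup.S, ModularGroup.T} := by
      simp [SpecialLinearGroup.SL2Z_generators]
    induction hg using Subgroup.closure_induction_right with
    | one => exact ⟨by simp [cross], by simpa using base⟩
    | mul_right x hx y hy ih =>
      rcases hy with rfl | rfl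
      · simpa [Matrix.mul_apply, Fin.sum_univ_two] using swapQ ih
      · simpa [Matrix.mul_apply, Fin.sum_univ_two] using addQ ih
    | mul_inv_cancel x hx y hy ih =>
      rcases hy with rfl | rfl
      · simpa [Matrix.mul_apply, Fin.sum_univ_two, SpecialLinearGroup.coe_inv,
          Matrix.adjugate_fin_two] using swapQ (swapQ (swapQ ih))
      · simpa [Matrix.mul_apply, Fin.sum_univ_two, SpecialLinearGroup.coe_inv,
          Matrix.adjugate_fin_two, sub_eq_add_neg, add_comm] using
          swapQ (swapQ (swapQ (addQ (swapQ (addQ (swapQ ih))))))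
  have := key ⟨!![v.1, w.1; v.2, w.2], by
    rw [Matrix.det_fin_two_of]; simp only [cross] at h; linarith⟩
  simpa using this.2

variable {a b c : ℝ} {T : ℤ × ℤ → ℝ}

theorem primitive_left_of_cross {v w : ℤ × ℤ} (h : cross v w ^ 2 = 1) : Primitive v :=
  ⟨w.2 * cross v w, -w.1 * cross v w, by rw [← h]; simp only [cross]; ring⟩

theorem cross_sq_comm (v w : ℤ × ℤ) : cross v w ^ 2 = cross w v ^ 2 := by
  simp only [cross]; ring

theorem cross_add_smul {v w : ℤ × ℤ} (j : ℤ) : cross v (w + j • v) = cross v w := by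
  simp only [cross, Prod.fst_add, Prod.snd_add, Prod.smul_fst, Prod.smul_snd, smul_eq_mul]; ring

theorem exists_cross_eq_one {v : ℤ × ℤ} (h : Primitive v) : ∃ w, cross v w = 1 := by
  obtain ⟨r, s, h⟩ := h
  exact ⟨(-s, r), by simp only [cross]; linarith⟩

namespace IsTraceFunction

theorem add_eq (hT : IsTraceFunction a b c T) {v w : ℤ × ℤ} (h : cross v w ^ 2 = 1) :
    T (v + w) = T v * T w - T (v - w) :=
  hT.add_rule v w (primitive_left_of_cross h)
    (primitive_left_of_cross (by rwa [cross_sq_comm]))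
    (eq_or_eq_neg_of_sq_eq_sq _ 1 (by rwa [one_pow]))

theorem apply_sub_comm (hT : IsTraceFunction a b c T) {v w : ℤ × ℤ} (h : cross v w ^ 2 = 1) :
    T (v - w) = T (w - v) := by
  rw [← neg_sub, hT.neg_eq _ (primitive_left_of_cross (w := w) _)]
  rw [← h]; simp only [cross, Prod.fst_sub, Prod.snd_sub]; ring

theorem pos_and_markoff (hT : IsTraceFunction a b c T) (ha : 2 < a) (hb : 2 < b) (hc : 2 < c)
    (habc : a ^ 2 + b ^ 2 + c ^ 2 = a * b * c) {v w : ℤ × ℤ} (h : cross v w = 1) :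
    0 < T v ∧ 0 < T w ∧ 0 < T (v + w) ∧
      T v ^ 2 + T w ^ 2 + T (v + w) ^ 2 = T v * T w * T (v + w) := by
  refine basis_induction (P := fun v w ↦ 0 < T v ∧ 0 < T w ∧ 0 < T (v + w) ∧
      T v ^ 2 + T w ^ 2 + T (v + w) ^ 2 = T v * T w * T (v + w)) ?_ ?_ ?_ h
  · simp only [Prod.mk_add_mk, add_zero, zero_add, hT.map_01, hT.map_11, hT.map_10]
    exact ⟨by linarith, by linarith, by linarith, by linarith⟩
  · rintro v w h ⟨hv, hw, hs, hm⟩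
    have h2 : cross v w ^ 2 = 1 := by rw [h]; rfl
    have e := hT.add_eq h2
    rw [hT.neg_eq v (primitive_left_of_cross h2), ← sub_eq_add_neg, ← hT.apply_sub_comm h2]
    have hd : T (v - w) = T v * T w - T (v + w) := by linarith
    have hp : T (v - w) * T (v + w) = T v ^ 2 + T w ^ 2 := by rw [hd]; linarith
    refine ⟨hw, hv, pos_of_mul_pos_left (hp ▸ by positivity) hs.le, ?_⟩
    rw [hd]; linear_combination hm
  · rintro v w h ⟨hv, hw, hs, hm⟩
    have h3 : cross v (v + w) ^ 2 = 1 := by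
      rw [show cross v (v + w) = cross v w by simp only [cross, Prod.fst_add, Prod.snd_add]; ring, h]
      rfl
    have h2 : cross w v ^ 2 = 1 := by rw [cross_sq_comm, h]; rfl
    have e := hT.add_eq h3
    have hd : T (v - (v + w)) = T w := by
      rw [sub_add_cancel_left, hT.neg_eq w (primitive_left_of_cross h2)]
    rw [hd] at e
    have hp : T (v + (v + w)) * T w = T v ^ 2 + T (v + w) ^ 2 := by rw [e]; linarith
    refine ⟨hv, hs, pos_of_mul_pos_left (hp ▸ by positivity) hw.le, ?_⟩
    rw [e]; linear_combination hm

end IsTraceFunction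

/-- A trace function with positive Markoff values, stated without its three initial values. -/
structure IsMarkoffTrace (T : ℤ × ℤ → ℝ) : Prop where
  neg_eq : ∀ v, Primitive v → T (-v) = T v
  add_eq : ∀ v w, cross v w ^ 2 = 1 → T (v + w) = T v * T w - T (v - w)
  two_lt : ∀ v, Primitive v → 2 < T v
  markoff : ∀ v w, cross v w ^ 2 = 1 →
    T v ^ 2 + T w ^ 2 + T (v + w) ^ 2 = T v * T w * T (v + w)

theorem IsTraceFunction.isMarkoffTrace (hT : IsTraceFunction a b c T) (ha : 2 < a) (hb : 2 < b)
    (hc : 2 < c) (habc : a ^ 2 + b ^ 2 + c ^ 2 = a * b * c) : IsMarkoffTrace T where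
  neg_eq := hT.neg_eq
  add_eq _ _ h := hT.add_eq h
  two_lt v hv := by
    obtain ⟨w, hw⟩ := exists_cross_eq_one hv
    obtain ⟨h1, h2, h3, h4⟩ := hT.pos_and_markoff ha hb hc habc hw
    have : 2 * (T w * T (v + w)) < T v * (T w * T (v + w)) := by
      nlinarith [sq_nonneg (T w - T (v + w)), pow_pos h1 2]
    exact lt_of_mul_lt_mul_right this (by positivity)
  markoff v w h := by
    rcases eq_or_eq_neg_of_sq_eq_sq _ 1 (h.trans (one_pow 2).symm) with h | h
    · exact (hT.pos_and_markoff ha hb hc habc h).2.2.2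
    · have := (hT.pos_and_markoff ha hb hc habc (v := w) (w := v)
        (by simp only [cross] at h ⊢; linarith)).2.2.2
      rw [add_comm w v] at this
      linear_combination this

/-- Half of the hyperbolic length of trace `t`, i.e. the inverse of `x ↦ 2 cosh x`. -/
noncomputable def halfLength (t : ℝ) : ℝ := Real.log ((t + Real.sqrt (t ^ 2 - 4)) / 2)

theorem exp_halfLength_add_inv {t : ℝ} (ht : 2 < t) :
    Real.exp (halfLength t) + (Real.exp (halfLength t))⁻¹ = t := by
  have hs := Real.sqrt_nonneg (t ^ 2 - 4)
  have hq := Real.sq_sqrt (show 0 ≤ t ^ 2 - 4 by nlinarith)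
  rw [halfLength, Real.exp_log (by linarith)]
  field_simp
  linear_combination hq

theorem halfLength_pos {t : ℝ} (ht : 2 < t) : 0 < halfLength t :=
  Real.log_pos (by linarith [Real.sqrt_nonneg (t ^ 2 - 4)])

theorem abs_le_halfLength {s t : ℝ} (ht : 2 < t) (h : Real.exp s + (Real.exp s)⁻¹ ≤ t) :
    |s| ≤ halfLength t := by
  rw [← abs_of_pos (halfLength_pos ht), ← Real.cosh_le_cosh, Real.cosh_eq, Real.cosh_eq,
    Real.exp_neg, Real.exp_neg, exp_halfLength_add_inv ht]
  linarith

namespace IsMarkoffTrace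

theorem apply_sub_comm (hT : IsMarkoffTrace T) {v w : ℤ × ℤ} (h : cross v w ^ 2 = 1) :
    T (v - w) = T (w - v) := by
  rw [← neg_sub, hT.neg_eq _ (primitive_left_of_cross (w := w) _)]
  rw [← h]; simp only [cross, Prod.fst_sub, Prod.snd_sub]; ring

/-- Along an arithmetic progression the traces satisfy a linear recurrence, solved here. -/
theorem exists_apply_add_smul_eq (hT : IsMarkoffTrace T) {v w : ℤ × ℤ}
    (h : cross v w ^ 2 = 1) :
    ∃ A B : ℝ, 0 < A ∧ 0 < B ∧ A + B = T w ∧ (T v ^ 2 - 4) * (A * B - 1) = 4 ∧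
      (T (w - v) ≤ T (w + v) → B ≤ A) ∧
      ∀ j : ℤ, T (w + j • v) = A * Real.exp (j * halfLength (T v)) +
        B * (Real.exp (j * halfLength (T v)))⁻¹ := by
  have h' : cross w v ^ 2 = 1 := by rwa [cross_sq_comm]
  have ht := hT.two_lt v (primitive_left_of_cross h)
  have hy := hT.two_lt w (primitive_left_of_cross h')
  have hadd := hT.add_eq w v h'
  have hmark := hT.markoff w v h'
  obtain ⟨θ, hθ⟩ : ∃ θ, θ = halfLength (T v) := ⟨_, rfl⟩
  obtain ⟨l, hl⟩ : ∃ l, l = Real.exp θ := ⟨_, rfl⟩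
  obtain ⟨m, hm⟩ : ∃ m, m = l⁻¹ := ⟨_, rfl⟩
  have hl1 : 1 < l := hl ▸ Real.one_lt_exp_iff.2 (hθ ▸ halfLength_pos ht)
  have hlt : l + m = T v := by rw [hm, hl, hθ]; exact exp_halfLength_add_inv ht
  have hlm : l * m = 1 := hm ▸ mul_inv_cancel₀ (by positivity)
  have hD : 0 < l - m := by linarith [hm ▸ inv_lt_one_of_one_lt₀ hl1]
  have hD2 : (l - m) ^ 2 = T v ^ 2 - 4 := by rw [← hlt]; linear_combination (-4) * hlm
  obtain ⟨A, hA⟩ : ∃ A, A * (l - m) = T (w + v) - T w * m := ⟨_, div_mul_cancel₀ _ hD.ne'⟩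
  obtain ⟨B, hB⟩ : ∃ B, B * (l - m) = T w * l - T (w + v) := ⟨_, div_mul_cancel₀ _ hD.ne'⟩
  have hAB : (A * B) * (l - m) ^ 2 = T v ^ 2 := by
    rw [show (A * B) * (l - m) ^ 2 = (A * (l - m)) * (B * (l - m)) by ring, hA, hB]
    linear_combination (T (w + v) * T w) * hlt - T w ^ 2 * hlm - hmark
  have hsum : A + B = T w := mul_right_cancel₀ hD.ne' (by linear_combination hA + hB)
  have hABpos : 0 < A * B := pos_of_mul_pos_left (hAB ▸ by positivity) (sq_nonneg (l - m))
  have hApos : 0 < A := by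
    by_contra! hneg
    have : B ≤ 0 := by nlinarith
    linarith
  have hBpos : 0 < B := pos_of_mul_pos_right hABpos hApos.le
  refine ⟨A, B, hApos, hBpos, hsum, by rw [← hD2]; linear_combination hAB - hD2, fun hle ↦ ?_, ?_⟩
  · have : (A - B) * (l - m) = 2 * T (w + v) - T w * T v := by
      linear_combination hA - hB - T w * hlt
    linarith [nonneg_of_mul_nonneg_left (show 0 ≤ (A - B) * (l - m) by linarith) hD]
  · rw [← hθ]
    have hexp (j : ℤ) : Real.exp ((j + 1 : ℤ) * θ) = Real.exp (j * θ) * l := by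
      rw [hl, ← Real.exp_add]; push_cast; ring_nf
    have hrec (j : ℤ) : T (w + (j + 1) • v) = T (w + j • v) * T v - T (w + (j - 1) • v) := by
      have := hT.add_eq (w + j • v) v (by rw [cross_sq_comm, cross_add_smul]; exact h)
      rwa [show w + j • v + v = w + (j + 1) • v by module,
        show w + j • v - v = w + (j - 1) • v by module] at this
    have key (j : ℤ) :
        (T (w + j • v) = A * Real.exp (j * θ) + B * (Real.exp (j * θ))⁻¹) ∧
        (T (w + (j + 1) • v) = A * (Real.exp (j * θ) * l) + B * ((Real.exp (j * θ))⁻¹ * m)) := by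
      induction j using Int.induction_on with
      | zero =>
        simp only [Int.cast_zero, zero_mul, Real.exp_zero, zero_smul, add_zero, zero_add, one_smul,
          inv_one, mul_one, one_mul, hsum, true_and]
        exact mul_right_cancel₀ hD.ne' (by linear_combination (-l) * hA - m * hB)
      | succ i ih =>
        obtain ⟨h1, h2⟩ := ih
        rw [hexp, mul_inv, ← hm]
        refine ⟨h2, ?_⟩
        have := hrec (i + 1)
        rw [h2, add_sub_cancel_right, h1, ← hlt] at this
        rw [this]
        linear_combination (A * Real.exp ((i : ℤ) * θ) + B * (Real.exp ((i : ℤ) * θ))⁻¹) * hlm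
      | pred i ih =>
        obtain ⟨h1, h2⟩ := ih
        have he := hexp (-i - 1)
        rw [sub_add_cancel] at he
        rw [he, mul_inv, ← hm] at h1 h2
        rw [sub_add_cancel]
        refine ⟨?_, h1⟩
        have := hrec (-i)
        rw [h2, h1, ← hlt] at this
        linear_combination this + (A * Real.exp ((-i - 1 : ℤ) * θ) +
          B * (Real.exp ((-i - 1 : ℤ) * θ))⁻¹) * hlm
    exact fun j ↦ (key j).1

/-- The lengths along an arithmetic progression dominate an affine function, which is nearly
attained when the traces increase. -/
theorem exists_shift (hT : IsMarkoffTrace T) {v w : ℤ × ℤ} (h : cross v w ^ 2 = 1) :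
    ∃ s : ℝ, (∀ j : ℤ, |s + j * halfLength (T v)| ≤ halfLength (T (w + j • v))) ∧
      (T (w - v) ≤ T (w + v) →
        (T v ^ 2 - 4) * (T w ^ 2 - 4) * (halfLength (T w) - s) ≤ 16) := by
  have h' : cross w v ^ 2 = 1 := by rwa [cross_sq_comm]
  have ht := hT.two_lt v (primitive_left_of_cross h)
  have hy := hT.two_lt w (primitive_left_of_cross h')
  have ht4 : 0 < T v ^ 2 - 4 := by nlinarith
  have hy4 : 0 < T w ^ 2 - 4 := by nlinarith
  obtain ⟨A, B, hA, hB, hsum, hAB, hle, hj⟩ := hT.exists_apply_add_smul_eq h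
  refine ⟨Real.log A, fun j ↦ abs_le_halfLength (hT.two_lt _
    (primitive_left_of_cross (w := v) ?_)) ?_, fun hinc ↦ ?_⟩
  · rwa [cross_sq_comm, cross_add_smul]
  · have hAB1 : 1 ≤ A * B := by
      linarith [pos_of_mul_pos_right (show 0 < (T v ^ 2 - 4) * (A * B - 1) by linarith) ht4.le]
    rw [Real.exp_add, Real.exp_log hA, hj, mul_inv]
    gcongr
    exact (inv_le_iff_one_le_mul₀' hA).2 hAB1
  · obtain ⟨X, hX⟩ : ∃ X, X = Real.exp (halfLength (T w)) := ⟨_, rfl⟩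
    have hX1 : 1 < X := hX ▸ Real.one_lt_exp_iff.2 (halfLength_pos hy)
    have hXy : X + X⁻¹ = T w := hX ▸ exp_halfLength_add_inv hy
    have hAy : T w / 2 ≤ A := by linarith [hle hinc]
    have hXi : X⁻¹ ≤ 1 := (inv_lt_one_of_one_lt₀ hX1).le
    have hXX : X * X⁻¹ = 1 := mul_inv_cancel₀ (by positivity)
    have hlog : halfLength (T w) - Real.log A ≤ X / A - 1 := by
      have := Real.log_le_sub_one_of_pos (show 0 < X / A by positivity)
      rwa [Real.log_div (by positivity) hA.ne', hX, Real.log_exp, ← hX] at this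
    obtain ⟨u, hu⟩ : ∃ u, u = X / A - 1 := ⟨_, rfl⟩
    have huA : (u + 1) * A = X := by rw [hu]; field_simp; ring
    have hprod : (T v ^ 2 - 4) * (u * (A * (A - X⁻¹))) = 4 := by
      have : u * A = X - A := by linarith
      linear_combination (T v ^ 2 - 4) * ((A - X⁻¹) * this + A * hXy - A * hsum - hXX) + hAB
    have hlow : (T w ^ 2 - 4) / 4 ≤ A * (A - X⁻¹) := by
      have h1 : X⁻¹ ≤ 2 / T w := by
        rw [inv_le_comm₀ (by positivity) (by positivity), inv_div]; linarith
      have h2 : T w / 2 - 2 / T w ≤ A - X⁻¹ := by linarith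
      have h3 : (T w ^ 2 - 4) / 4 = T w / 2 * (T w / 2 - 2 / T w) := by field_simp; ring
      rw [h3]
      refine mul_le_mul hAy h2 ?_ hA.le
      rw [sub_nonneg, div_le_div_iff₀ (by linarith) (by norm_num)]; nlinarith
    have hu0 : 0 ≤ u := by
      refine (pos_of_mul_pos_left (b := (T v ^ 2 - 4) * (A * (A - X⁻¹))) (by linarith) ?_).le
      have : 0 < A * (A - X⁻¹) := lt_of_lt_of_le (by linarith) hlow
      positivity
    calc _ ≤ (T v ^ 2 - 4) * (T w ^ 2 - 4) * u := by rw [hu]; gcongr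
      _ = 4 * ((T v ^ 2 - 4) * (u * ((T w ^ 2 - 4) / 4))) := by ring
      _ ≤ 4 * ((T v ^ 2 - 4) * (u * (A * (A - X⁻¹)))) := by gcongr
      _ = 16 := by rw [hprod]; norm_num

end IsMarkoffTrace

/-- Nonnegativity on a cone of `ℤ²` spreads through the Stern–Brocot tree for a function that is
convex along unimodular relations. -/
theorem nonneg_on_cone {e : ℤ × ℤ → ℝ}
    (he : ∀ x y, cross x y ^ 2 = 1 → ∀ k : ℕ, k * e x ≤ e ((k : ℤ) • x - y) + e y)
    {p q : ℕ} (hpq : p.Coprime q) {x y : ℤ × ℤ} {k : ℕ} (hxy : cross x y ^ 2 = 1) (hk : 1 ≤ k)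
    (hx : 0 ≤ e x) (hd : e ((k : ℤ) • x - y) ≤ e x) :
    0 ≤ e ((p : ℤ) • x + (q : ℤ) • y) := by
  induction hn : p + q using Nat.strong_induction_on generalizing p q x y k with
  | _ n ih =>
    have hk' : (1 : ℝ) ≤ k := by exact_mod_cast hk
    rcases Nat.eq_zero_or_pos p with rfl | hp
    · obtain rfl : q = 1 := by simpa using hpq
      have := he x y hxy k
      simp only [Nat.cast_zero, zero_smul, Nat.cast_one, one_smul, zero_add]
      nlinarith
    rcases Nat.eq_zero_or_pos q with rfl | hq
    · obtain rfl : p = 1 := by simpa using hpq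
      simpa using hx
    have h1 : cross x (x + y) ^ 2 = 1 := by
      rw [← hxy]; simp only [cross, Prod.fst_add, Prod.snd_add]; ring
    have h2 : ((k + 1 : ℕ) : ℤ) • x - (x + y) = (k : ℤ) • x - y := by push_cast; module
    rcases le_total q p with hle | hle
    · have := ih (p - q + q) (by omega) (p := p - q) (q := q)
        ((Nat.coprime_sub_self_left hle).2 hpq) h1 (Nat.le_add_left 1 k) hx (by rwa [h2]) rfl
      rw [Nat.cast_sub hle] at this
      rwa [show (p : ℤ) • x + (q : ℤ) • y = ((p : ℤ) - q) • x + (q : ℤ) • (x + y) by module]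
    · have h3 := he x (x + y) h1 (k + 1)
      rw [h2] at h3
      push_cast at h3
      have h4 : e x ≤ e (x + y) := by nlinarith
      have := ih (p + (q - p)) (by omega) (p := p) (q := q - p)
        ((Nat.coprime_sub_self_right hle).2 hpq) (x := x + y) (y := y) (k := 1)
        (by rw [← hxy]; simp only [cross, Prod.fst_add, Prod.snd_add]; ring) le_rfl
        (hx.trans h4) (by simpa using h4) rfl
      rw [Nat.cast_sub hle] at this
      rwa [show (p : ℤ) • x + (q : ℤ) • y = (p : ℤ) • (x + y) + ((q : ℤ) - p) • y by module]

namespace IsMarkoffTrace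

theorem mul_halfLength_le (hT : IsMarkoffTrace T) {x y : ℤ × ℤ} (h : cross x y ^ 2 = 1) (k : ℕ) :
    k * halfLength (T x) ≤ halfLength (T ((k : ℤ) • x - y)) + halfLength (T y) := by
  obtain ⟨s, hs, -⟩ := hT.exists_shift h
  have h0 := hs 0
  have hk := hs (-k)
  rw [show y + (-k : ℤ) • x = -((k : ℤ) • x - y) by module,
    hT.neg_eq _ (primitive_left_of_cross (w := x) _)] at hk
  · simp only [Int.cast_zero, zero_mul, add_zero, zero_smul] at h0
    push_cast at hk
    linarith [le_abs_self s, neg_abs_le (s + -(k : ℝ) * halfLength (T x))]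
  · rw [← h]
    simp only [cross, Prod.fst_sub, Prod.snd_sub, Prod.smul_fst, Prod.smul_snd, smul_eq_mul]
    ring

/-- An affine minorant of the lengths along one progression is a minorant on the half plane. -/
theorem le_halfLength_of_pos (hT : IsMarkoffTrace T) {α β : ℝ} {v w : ℤ × ℤ}
    (h : cross v w ^ 2 = 1) (hv : α * v.1 + β * v.2 = halfLength (T v))
    (hw : ∀ j : ℤ, |α * w.1 + β * w.2 + j * halfLength (T v)| ≤ halfLength (T (w + j • v)))
    {p q : ℤ} (hpq : IsCoprime p q) (hq : 0 < q) :
    α * (p • v + q • w).1 + β * (p • v + q • w).2 ≤ halfLength (T (p • v + q • w)) := by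
  set e : ℤ × ℤ → ℝ := fun u ↦ halfLength (T u) - (α * u.1 + β * u.2) with he
  obtain ⟨j, hj⟩ : ∃ j, j = p / q := ⟨_, rfl⟩
  obtain ⟨r, hr⟩ : ∃ r : ℕ, (r : ℤ) = p % q := ⟨_, Int.toNat_of_nonneg (Int.emod_nonneg p hq.ne')⟩
  have hrq : (r : ℤ) < q := hr ▸ Int.emod_lt_of_pos p hq
  obtain ⟨m, hm⟩ : ∃ m : ℕ, (m : ℤ) = q - r := ⟨_, Int.toNat_of_nonneg (by omega)⟩
  have hp : p = j * q + r := by rw [hj, hr, mul_comm]; exact (Int.mul_ediv_add_emod p q).symm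
  obtain rfl : q = m + r := by omega
  have hcop : r.Coprime m := by
    rw [← Nat.isCoprime_iff_coprime]
    have h1 : IsCoprime (r : ℤ) (m + r) := by
      rw [hp, add_comm] at hpq
      exact IsCoprime.of_add_mul_right_left hpq
    exact IsCoprime.of_add_mul_right_right (z := 1) (by rwa [one_mul])
  have hbase (j : ℤ) : 0 ≤ e (w + j • v) := by
    have := (le_abs_self _).trans (hw j)
    simp only [he, Prod.fst_add, Prod.snd_add, Prod.smul_fst, Prod.smul_snd, smul_eq_mul]
    push_cast
    rw [← hv] at this
    linarith
  have := nonneg_on_cone (e := e) (fun x y hxy k ↦ ?_) hcop (x := w + (j + 1) • v) (y := w + j • v)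
    (k := 1) ?_ le_rfl (hbase _) ?_
  · rw [show (r : ℤ) • (w + (j + 1) • v) + (m : ℤ) • (w + j • v) =
      p • v + ((m : ℤ) + r) • w by rw [hp]; module] at this
    simpa [he] using this
  · have := hT.mul_halfLength_le hxy k
    simp only [he, Prod.fst_sub, Prod.snd_sub, Prod.smul_fst, Prod.smul_snd, smul_eq_mul]
    push_cast
    linarith
  · rw [show cross (w + (j + 1) • v) (w + j • v) = cross v w by
      simp only [cross, Prod.fst_add, Prod.snd_add, Prod.smul_fst, Prod.smul_snd, smul_eq_mul]
      ring, h]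
  · rw [show ((1 : ℕ) : ℤ) • (w + (j + 1) • v) - (w + j • v) = v by push_cast; module]
    refine le_trans (le_of_eq ?_) (hbase _)
    simp only [he, hv, sub_self]

/-- The functional touching the lengths at `v` and dominated along a transversal progression is
dominated everywhere. -/
theorem le_halfLength (hT : IsMarkoffTrace T) {α β : ℝ} {v w : ℤ × ℤ}
    (h : cross v w ^ 2 = 1) (hv : α * v.1 + β * v.2 = halfLength (T v))
    (hw : ∀ j : ℤ, |α * w.1 + β * w.2 + j * halfLength (T v)| ≤ halfLength (T (w + j • v)))
    {u : ℤ × ℤ} (hu : Primitive u) :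
    α * u.1 + β * u.2 ≤ halfLength (T u) := by
  obtain ⟨p, hp⟩ : ∃ p, p = cross v w * cross u w := ⟨_, rfl⟩
  obtain ⟨q, hq⟩ : ∃ q, q = cross v w * cross v u := ⟨_, rfl⟩
  have hdec : u = p • v + q • w := by
    rw [hp, hq]
    ext
    · simp only [cross, Prod.fst_add, Prod.smul_fst, smul_eq_mul] at h ⊢
      linear_combination (-u.1) * h
    · simp only [cross, Prod.snd_add, Prod.smul_snd, smul_eq_mul] at h ⊢
      linear_combination (-u.2) * h
  have hpq : IsCoprime p q := by
    obtain ⟨a, b, hab⟩ := hu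
    refine ⟨a * v.1 + b * v.2, a * w.1 + b * w.2, ?_⟩
    have h1 := congrArg Prod.fst hdec
    have h2 := congrArg Prod.snd hdec
    simp only [Prod.fst_add, Prod.snd_add, Prod.smul_fst, Prod.smul_snd, smul_eq_mul] at h1 h2
    linear_combination hab - a * h1 - b * h2
  rcases lt_trichotomy q 0 with hq0 | hq0 | hq0
  · have := hT.le_halfLength_of_pos (w := -w) (by
      rw [← h]; simp only [cross, Prod.fst_neg, Prod.snd_neg]; ring) hv (fun j ↦ ?_)
      (p := p) (q := -q) hpq.neg_right (by omega)
    · rwa [smul_neg, neg_smul, neg_neg, ← hdec] at this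
    · rw [show -w + j • v = -(w + (-j) • v) by module,
        hT.neg_eq _ (primitive_left_of_cross (w := v) _)]
      · refine le_trans (le_of_eq ?_) (hw (-j))
        rw [← abs_neg, Prod.fst_neg, Prod.snd_neg]
        push_cast
        ring_nf
      · rwa [cross_sq_comm, cross_add_smul]
  · have hpos := halfLength_pos (hT.two_lt v (primitive_left_of_cross h))
    rw [hq0, isCoprime_zero_right, Int.isUnit_iff] at hpq
    rw [hq0, zero_smul, add_zero] at hdec
    rcases hpq with rfl | rfl
    · rw [hdec, one_smul, hv]
    · rw [hdec, neg_one_smul, hT.neg_eq v (primitive_left_of_cross h), Prod.fst_neg, Prod.snd_neg]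
      push_cast
      linarith
  · rw [hdec]
    exact hT.le_halfLength_of_pos h hv hw hpq hq0

/-- A dominated functional touching at `v`, almost touching at a neighbour `w`. -/
theorem exists_support (hT : IsMarkoffTrace T) {v w : ℤ × ℤ} (h : cross v w ^ 2 = 1) :
    ∃ α β : ℝ, (∀ u, Primitive u → α * u.1 + β * u.2 ≤ halfLength (T u)) ∧
      α * v.1 + β * v.2 = halfLength (T v) ∧
      (T (w - v) ≤ T (w + v) →
        (T v ^ 2 - 4) * (T w ^ 2 - 4) * (halfLength (T w) - (α * w.1 + β * w.2)) ≤ 16) := by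
  obtain ⟨s, hs, hle⟩ := hT.exists_shift h
  have hR : (cross v w : ℝ) ^ 2 = 1 := by exact_mod_cast h
  have hc : (cross v w : ℝ) = v.1 * w.2 - v.2 * w.1 := by simp only [cross]; push_cast; ring
  obtain ⟨α, hα⟩ : ∃ α, α = (cross v w : ℝ) * (w.2 * halfLength (T v) - v.2 * s) := ⟨_, rfl⟩
  obtain ⟨β, hβ⟩ : ∃ β, β = (cross v w : ℝ) * (v.1 * s - w.1 * halfLength (T v)) := ⟨_, rfl⟩
  have hv : α * v.1 + β * v.2 = halfLength (T v) := by
    rw [hc] at hR hα hβ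
    rw [hα, hβ]
    linear_combination halfLength (T v) * hR
  have hw : α * w.1 + β * w.2 = s := by
    rw [hc] at hR hα hβ
    rw [hα, hβ]
    linear_combination s * hR
  exact ⟨α, β, fun u hu ↦ hT.le_halfLength h hv (by rwa [hw]) hu, hv, by rwa [hw]⟩

end IsMarkoffTrace

/-- `x` lies strictly between the Farey neighbours `v.1 / v.2` and `w.1 / w.2`. -/
structure IsFareyPair (x : ℝ) (v w : ℤ × ℤ) : Prop where
  cross_eq : cross v w = -1
  left_pos : 0 < v.2
  right_pos : 0 < w.2
  left_lt : v.1 < x * v.2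
  lt_right : x * w.2 < w.1

namespace IsFareyPair

variable {x : ℝ} {v w : ℤ × ℤ}

theorem cross_sq (h : IsFareyPair x v w) : cross v w ^ 2 = 1 := by rw [h.cross_eq]; rfl

theorem exists_of_irrational (hx : Irrational x) : ∃ v w, IsFareyPair x v w := by
  refine ⟨(⌊x⌋, 1), (⌊x⌋ + 1, 1), by simp [cross], one_pos, one_pos, ?_, ?_⟩
  · simpa using lt_of_le_of_ne (Int.floor_le x) (hx.ne_int _).symm
  · simp

theorem mediant (h : IsFareyPair x v w) (hx : Irrational x) :
    IsFareyPair x v (w + v) ∨ IsFareyPair x (w + v) w := by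
  have hpos : 0 < w.2 + v.2 := add_pos h.right_pos h.left_pos
  have hc := h.cross_eq
  have hne : x * ((w.2 + v.2 : ℤ) : ℝ) ≠ ((w.1 + v.1 : ℤ) : ℝ) :=
    (hx.mul_intCast hpos.ne').ne_int _
  rcases lt_or_gt_of_ne hne with hlt | hlt
  · exact .inl ⟨by rw [← hc]; simp only [cross, Prod.fst_add, Prod.snd_add]; ring,
      h.left_pos, hpos, h.left_lt, hlt⟩
  · exact .inr ⟨by rw [← hc]; simp only [cross, Prod.fst_add, Prod.snd_add]; ring,
      hpos, h.right_pos, hlt, h.lt_right⟩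

end IsFareyPair

theorem le_of_markoff_of_lt {x y m M : ℝ} (hx : 2 < x) (hy : 2 < y) (hm : 2 < m)
    (hmark : y ^ 2 + x ^ 2 + m ^ 2 = y * x * m) (hlt : x * m < 2 * y) (hM : y ≤ M) :
    16 / M ^ 2 ≤ y * x - 2 * m := by
  have h1 : x ^ 2 - 4 ≤ y * x - 2 * m := by nlinarith
  have h2 : 16 ≤ (x ^ 2 - 4) * y ^ 2 := by nlinarith [sq_nonneg (2 * m - y * x)]
  have h3 : 16 ≤ (x ^ 2 - 4) * M ^ 2 :=
    h2.trans (mul_le_mul_of_nonneg_left (by gcongr) (by nlinarith))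
  exact ((div_le_iff₀ (by nlinarith)).2 h3).trans h1

namespace IsMarkoffTrace

variable {x : ℝ} {v w : ℤ × ℤ}

theorem apply_mediant (hT : IsMarkoffTrace T) (h : cross v w ^ 2 = 1) :
    2 < T v ∧ 2 < T w ∧ 2 < T (w + v) ∧ T (w + v) = T w * T v - T (w - v) ∧
      T w ^ 2 + T v ^ 2 + T (w + v) ^ 2 = T w * T v * T (w + v) ∧
      T (w + v - v) = T w ∧ T (w - (w + v)) = T v ∧
      T (w + v + v) = T (w + v) * T v - T w ∧ T (w + (w + v)) = T w * T (w + v) - T v := by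
  have h' : cross w v ^ 2 = 1 := by rwa [cross_sq_comm]
  have h1 : cross (w + v) v ^ 2 = 1 := by
    rw [← h']; simp only [cross, Prod.fst_add, Prod.snd_add]; ring
  have h2 : cross w (w + v) ^ 2 = 1 := by
    rw [← h']; simp only [cross, Prod.fst_add, Prod.snd_add]; ring
  have e1 : T (w + v - v) = T w := by rw [add_sub_cancel_right]
  have e2 : T (w - (w + v)) = T v := by
    rw [sub_add_cancel_left, hT.neg_eq v (primitive_left_of_cross h)]
  exact ⟨hT.two_lt v (primitive_left_of_cross h), hT.two_lt w (primitive_left_of_cross h'),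
    hT.two_lt _ (primitive_left_of_cross h1), hT.add_eq w v h', hT.markoff w v h', e1, e2,
    e1 ▸ hT.add_eq _ _ h1, e2 ▸ hT.add_eq _ _ h2⟩

/-- The traces cannot decrease forever along the Farey path towards an irrational. -/
theorem exists_increasing_fareyPair (hT : IsMarkoffTrace T) (hx : Irrational x) :
    ∃ v w, IsFareyPair x v w ∧ T (w - v) ≤ T (w + v) := by
  by_contra! H
  obtain ⟨v₀, w₀, h₀⟩ := IsFareyPair.exists_of_irrational hx
  obtain ⟨M, hM1, hM2, hM3⟩ : ∃ M, T v₀ ≤ M ∧ T w₀ ≤ M ∧ T (w₀ - v₀) ≤ M :=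
    ⟨max (T v₀) (max (T w₀) (T (w₀ - v₀))), by simp, by simp, by simp⟩
  have hMpos : 0 < M := by linarith [(hT.apply_mediant h₀.cross_sq).1]
  have descend (n : ℕ) : ∃ v w, IsFareyPair x v w ∧ T v ≤ M ∧ T w ≤ M ∧ T (w - v) ≤ M ∧
      T v + T w + T (w - v) ≤ 3 * M - n * (16 / M ^ 2) := by
    induction n with
    | zero => exact ⟨v₀, w₀, h₀, hM1, hM2, hM3, by push_cast; linarith⟩
    | succ n ih =>
      obtain ⟨v, w, h, hv, hw, hd, hsum⟩ := ih
      obtain ⟨t1, t2, t3, hadd, hmark, e1, e2, e3, e4⟩ := hT.apply_mediant h.cross_sq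
      have hlt := H v w h
      push_cast
      rcases h.mediant hx with h' | h'
      · have hlt' := H _ _ h'
        rw [e1, e3] at hlt'
        have := le_of_markoff_of_lt t1 t2 t3 hmark (by linarith) hw
        exact ⟨_, _, h', hv, by linarith, by rwa [e1], by rw [e1]; linarith⟩
      · have hlt' := H _ _ h'
        rw [e2, e4] at hlt'
        have := le_of_markoff_of_lt t2 t1 t3 (by linarith) (by linarith) hv
        exact ⟨_, _, h', by linarith, hw, by rwa [e2], by rw [e2]; linarith⟩
  obtain ⟨n, hn⟩ := exists_nat_gt (3 * M / (16 / M ^ 2))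
  obtain ⟨v, w, h, -, -, -, hsum⟩ := descend n
  rw [div_lt_iff₀ (by positivity)] at hn
  have h2 := hT.apply_mediant h.cross_sq
  linarith [H v w h]

/-- Eventually the traces increase at least linearly along the Farey path. -/
theorem exists_fareyPair_linear_growth (hT : IsMarkoffTrace T) (hx : Irrational x) :
    ∃ c : ℝ, 0 < c ∧ ∀ n : ℕ, ∃ v w, IsFareyPair x v w ∧ T (w - v) ≤ T (w + v) ∧
      c * v.2 ≤ T v - 2 ∧ c * w.2 ≤ T w - 2 ∧ (n : ℝ) ≤ v.2 + w.2 := by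
  obtain ⟨v₀, w₀, h₀, hinc₀⟩ := hT.exists_increasing_fareyPair hx
  obtain ⟨a1, a2, -⟩ := hT.apply_mediant h₀.cross_sq
  have b1 : (0 : ℝ) < v₀.2 := by exact_mod_cast h₀.left_pos
  have b2 : (0 : ℝ) < w₀.2 := by exact_mod_cast h₀.right_pos
  refine ⟨min ((T v₀ - 2) / v₀.2) ((T w₀ - 2) / w₀.2),
    lt_min (div_pos (by linarith) b1) (div_pos (by linarith) b2), fun n ↦ ?_⟩
  set c := min ((T v₀ - 2) / v₀.2) ((T w₀ - 2) / w₀.2)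
  induction n with
  | zero =>
    exact ⟨v₀, w₀, h₀, hinc₀, (le_div_iff₀ b1).1 (min_le_left _ _),
      (le_div_iff₀ b2).1 (min_le_right _ _), by push_cast; linarith⟩
  | succ n ih =>
    obtain ⟨v, w, h, hinc, hv, hw, hn⟩ := ih
    obtain ⟨t1, t2, t3, hadd, -, e1, e2, e3, e4⟩ := hT.apply_mediant h.cross_sq
    have c1 : (1 : ℝ) ≤ v.2 := by exact_mod_cast h.left_pos
    have c2 : (1 : ℝ) ≤ w.2 := by exact_mod_cast h.right_pos
    have hm : T w * T v ≤ 2 * T (w + v) := by linarith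
    have hm2 : T v - 2 + (T w - 2) ≤ T (w + v) - 2 := by nlinarith
    have hmc : c * ((w + v).2 : ℤ) ≤ T (w + v) - 2 := by
      rw [Prod.snd_add]; push_cast; linarith
    rcases h.mediant hx with h' | h'
    · refine ⟨_, _, h', ?_, hv, hmc, ?_⟩
      · rw [e1, e3]; nlinarith
      · rw [Prod.snd_add]; push_cast; linarith
    · refine ⟨_, _, h', ?_, hmc, hw, ?_⟩
      · rw [e2, e4]; nlinarith
      · rw [Prod.snd_add]; push_cast; linarith

end IsMarkoffTrace

/-- The linear functionals `(p, q) ↦ α p + β q` dominated by the half-lengths. -/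
def dominatedFunctionals (T : ℤ × ℤ → ℝ) : Set (ℝ × ℝ) :=
  {l | ∀ u : ℤ × ℤ, Primitive u → l.1 * u.1 + l.2 * u.2 ≤ halfLength (T u)}

/-- The upper envelope of the dominated functionals on the line `q = 1`. -/
noncomputable def envelope (T : ℤ × ℤ → ℝ) (x : ℝ) : ℝ :=
  ⨆ l : dominatedFunctionals T, (l.1.1 * x + l.1.2)

namespace IsMarkoffTrace

theorem bddAbove_envelope (hT : IsMarkoffTrace T) (x : ℝ) :
    BddAbove (Set.range fun l : dominatedFunctionals T ↦ l.1.1 * x + l.1.2) := by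
  refine ⟨halfLength (T (1, 0)) * |x| + halfLength (T (0, 1)), ?_⟩
  rintro _ ⟨⟨l, hl⟩, rfl⟩
  have p1 : Primitive (1, 0) := isCoprime_one_left
  have h1 := hl (1, 0) p1
  have h2 := hl (-(1, 0)) (by simp [Primitive, isCoprime_zero_right])
  have h3 := hl (0, 1) isCoprime_one_right
  rw [hT.neg_eq _ p1] at h2
  simp only [Prod.fst_neg, Prod.snd_neg, neg_zero, Int.cast_neg, Int.cast_one, Int.cast_zero,
    mul_neg, mul_one, mul_zero, add_zero, zero_add] at h1 h2 h3
  have h4 : l.1 * x ≤ halfLength (T (1, 0)) * |x| := by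
    refine (le_abs_self _).trans ?_
    rw [abs_mul]
    exact mul_le_mul_of_nonneg_right (abs_le.2 ⟨by linarith, h1⟩) (abs_nonneg x)
  exact add_le_add h4 h3

theorem le_envelope (hT : IsMarkoffTrace T) {α β : ℝ} (h : (α, β) ∈ dominatedFunctionals T)
    (x : ℝ) : α * x + β ≤ envelope T x :=
  le_ciSup (hT.bddAbove_envelope x) ⟨(α, β), h⟩

theorem dominatedFunctionals_nonempty (hT : IsMarkoffTrace T) :
    (dominatedFunctionals T).Nonempty := by
  obtain ⟨α, β, h, -⟩ := hT.exists_support (v := (1, 0)) (w := (0, 1)) (by simp [cross])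
  exact ⟨(α, β), h⟩

theorem convexOn_envelope (hT : IsMarkoffTrace T) : ConvexOn ℝ Set.univ (envelope T) := by
  have := hT.dominatedFunctionals_nonempty.to_subtype
  refine ⟨convex_univ, fun x _ y _ r s hr hs hrs ↦ ciSup_le fun l ↦ ?_⟩
  have hx := mul_le_mul_of_nonneg_left (hT.le_envelope l.2 x) hr
  have hy := mul_le_mul_of_nonneg_left (hT.le_envelope l.2 y) hs
  simp only [smul_eq_mul]
  calc _ = r * (l.1.1 * x + l.1.2) + s * (l.1.1 * y + l.1.2) := by
        linear_combination (-l.1.2) * hrs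
    _ ≤ _ := add_le_add hx hy

theorem envelope_eq (hT : IsMarkoffTrace T) {v : ℤ × ℤ} (hv : Primitive v) (hpos : 0 < v.2) :
    envelope T (v.1 / v.2) = halfLength (T v) / v.2 := by
  have := hT.dominatedFunctionals_nonempty.to_subtype
  have hq : (0 : ℝ) < v.2 := by exact_mod_cast hpos
  have hlin (α β : ℝ) : α * (v.1 / v.2) + β = (α * v.1 + β * v.2) / v.2 := by field_simp
  apply le_antisymm
  · refine ciSup_le fun l ↦ ?_
    rw [hlin]
    gcongr
    exact l.2 v hv
  · obtain ⟨w, hw⟩ := exists_cross_eq_one hv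
    obtain ⟨α, β, h, hv', -⟩ := hT.exists_support (v := v) (w := w) (by rw [hw]; rfl)
    rw [← hv', ← hlin]
    exact hT.le_envelope h _

end IsMarkoffTrace

/-- A convex function is differentiable at a point if its affine supports at points on the two
sides have slopes differing by arbitrarily little. -/
theorem ConvexOn.differentiableAt_of_supports {G : ℝ → ℝ} (hG : ConvexOn ℝ Set.univ G) {x : ℝ}
    (h : ∀ ε > 0, ∃ α β y α' β' y' : ℝ, y < x ∧ x < y' ∧ G y = α * y + β ∧ α * x + β ≤ G x ∧
      G y' = α' * y' + β' ∧ α' * x + β' ≤ G x ∧ α' - α ≤ ε) :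
    DifferentiableAt ℝ G x := by
  have hx : x ∈ interior (Set.univ : Set ℝ) := by simp
  have hle := hG.leftDeriv_le_rightDeriv_of_mem_interior hx
  have hge : derivWithin G (Set.Ioi x) x ≤ derivWithin G (Set.Iio x) x := by
    refine le_of_forall_pos_le_add fun ε hε ↦ ?_
    obtain ⟨α, β, y, α', β', y', hy, hy', e1, e2, e3, e4, e5⟩ := h ε hε
    have h1 := hG.slope_le_leftDeriv_of_mem_interior (Set.mem_univ y) hx hy
    have h2 := hG.rightDeriv_le_slope_of_mem_interior hx (Set.mem_univ y') hy'
    have h3 : α ≤ slope G y x := by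
      rw [slope_def_field, le_div_iff₀ (by linarith)]; linarith
    have h4 : slope G x y' ≤ α' := by
      rw [slope_def_field, div_le_iff₀ (by linarith)]; linarith
    linarith
  have hl := (hG.hasDerivWithinAt_leftDeriv_of_mem_interior hx).Iic_of_Iio
  have hr := (hG.hasDerivWithinAt_rightDeriv_of_mem_interior hx).Ici_of_Ioi
  rw [le_antisymm hge hle] at hr
  have := hl.union hr
  rw [Set.Iic_union_Ici, hasDerivWithinAt_univ] at this
  exact this.differentiableAt

theorem IsMarkoffTrace.differentiableAt_envelope (hT : IsMarkoffTrace T) {x : ℝ}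
    (hx : Irrational x) : DifferentiableAt ℝ (envelope T) x := by
  refine hT.convexOn_envelope.differentiableAt_of_supports fun ε hε ↦ ?_
  obtain ⟨c, hc, hgrow⟩ := hT.exists_fareyPair_linear_growth hx
  obtain ⟨n, hn⟩ := exists_nat_gt (32 / (c ^ 3 * ε))
  obtain ⟨v, w, h, hinc, hv, hw, hnle⟩ := hgrow n
  have h2 : cross w v ^ 2 = 1 := by rw [cross_sq_comm, h.cross_sq]
  have pv := primitive_left_of_cross h.cross_sq
  have pw := primitive_left_of_cross h2
  obtain ⟨α, β, hd, htouch, hnear⟩ := hT.exists_support h.cross_sq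
  obtain ⟨α', β', hd', htouch', hnear'⟩ := hT.exists_support h2
  replace hnear := hnear hinc
  replace hnear' := hnear' (by rwa [hT.apply_sub_comm h.cross_sq, add_comm])
  have c1 : (1 : ℝ) ≤ v.2 := by exact_mod_cast h.left_pos
  have c2 : (1 : ℝ) ≤ w.2 := by exact_mod_cast h.right_pos
  have hlin (α β : ℝ) {u : ℤ × ℤ} (hu : (0 : ℝ) < u.2) :
      α * (u.1 / u.2) + β = (α * u.1 + β * u.2) / u.2 := by field_simp
  refine ⟨α, β, v.1 / v.2, α', β', w.1 / w.2, (div_lt_iff₀ (by linarith)).2 h.left_lt,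
    (lt_div_iff₀ (by linarith)).2 h.lt_right, ?_, hT.le_envelope hd x, ?_,
    hT.le_envelope hd' x, ?_⟩
  · rw [hT.envelope_eq pv h.left_pos, hlin _ _ (by linarith), htouch]
  · rw [hT.envelope_eq pw h.right_pos, hlin _ _ (by linarith), htouch']
  have hcross : (v.1 : ℝ) * w.2 - v.2 * w.1 = -1 := by exact_mod_cast h.cross_eq
  have hgap : α' - α = v.2 * (halfLength (T w) - (α * w.1 + β * w.2)) +
      w.2 * (halfLength (T v) - (α' * v.1 + β' * v.2)) := by
    rw [← htouch, ← htouch']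
    linear_combination (α' - α) * hcross
  generalize halfLength (T w) - (α * w.1 + β * w.2) = δ at hnear hgap
  generalize halfLength (T v) - (α' * v.1 + β' * v.2) = δ' at hnear' hgap
  generalize (v.2 : ℝ) = q at *
  generalize (w.2 : ℝ) = q' at *
  generalize T v = t at *
  generalize T w = y at *
  have hqq : q + q' ≤ 2 * (q * q') := by nlinarith
  have hcq : 0 < c * q := by positivity
  have hcq' : 0 < c * q' := by positivity
  have hprod : c ^ 3 * (q * q' * (q + q')) ≤ (t ^ 2 - 4) * (y ^ 2 - 4) := by
    calc _ = (c * q) * (c * q') * (c * q + c * q') := by ring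
      _ ≤ ((t - 2) * (y - 2)) * ((t + 2) * (y + 2)) := by
        gcongr
        · exact mul_nonneg (by linarith) (by linarith)
        · linarith
        · nlinarith
      _ = _ := by ring
  have hgap2 : (t ^ 2 - 4) * (y ^ 2 - 4) * (α' - α) ≤ 16 * (q + q') := by
    rw [hgap]; nlinarith
  by_contra! hlt
  have h3 : 32 < n * (c ^ 3 * ε) := (div_lt_iff₀ (by positivity)).1 hn
  have h4 : c ^ 3 * (q * q' * (q + q')) * ε ≤ 16 * (q + q') :=
    le_trans (mul_le_mul hprod hlt.le hε.le (le_trans (by positivity) hprod)) hgap2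
  have h5 : c ^ 3 * (q * q') * ε ≤ 16 := by
    refine le_of_mul_le_mul_right ?_ (show 0 < q + q' by linarith)
    linarith
  have h6 : n * (c ^ 3 * ε) ≤ 2 * (q * q') * (c ^ 3 * ε) := by gcongr; linarith
  linarith

theorem traceLength_eq (t : ℝ) : traceLength t = 2 * halfLength t := rfl

end

/-- For a Markoff triple of reals `(a,b,c)` with trace function `T`, the function `F`
on the rationals of `[0,1]` extends to a unique continuous function `G` on `[0,1]`;
this extension is convex on `[0,1]` and differentiable at every irrational point of
`(0,1)`. -/
theorem F_extends_convex_differentiable (a b c : ℝ) (ha : 2 < a) (hb : 2 < b)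
    (hc : 2 < c) (habc : a ^ 2 + b ^ 2 + c ^ 2 = a * b * c)
    (T : ℤ × ℤ → ℝ) (hT : IsTraceFunction a b c T) :
    ∃ G : ℝ → ℝ,
      (ContinuousOn G (Set.Icc 0 1) ∧
        (∀ r : ℚ, (r : ℝ) ∈ Set.Icc (0 : ℝ) 1 → G r = Ffun T r) ∧
        ConvexOn ℝ (Set.Icc 0 1) G ∧
        ∀ x ∈ Set.Ioo (0 : ℝ) 1, Irrational x →
          DifferentiableWithinAt ℝ G (Set.Icc 0 1) x) ∧
      ∀ G' : ℝ → ℝ, ContinuousOn G' (Set.Icc 0 1) →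
        (∀ r : ℚ, (r : ℝ) ∈ Set.Icc (0 : ℝ) 1 → G' r = Ffun T r) →
        Set.EqOn G G' (Set.Icc 0 1) := by
  have hM := hT.isMarkoffTrace ha hb hc habc
  have hrat (r : ℚ) : 2 * envelope T r = Ffun T r := by
    have h := hM.envelope_eq (v := (r.num, (r.den : ℤ))) (Rat.isCoprime_num_den r)
      (Int.natCast_pos.2 r.pos)
    rw [Ffun, traceLength_eq, mul_div_assoc, Rat.cast_def]
    simpa using h
  have hcont : Continuous (envelope T) :=
    continuousOn_univ.1 (hM.convexOn_envelope.continuousOn isOpen_univ)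
  have hconv : ConvexOn ℝ Set.univ (fun x ↦ 2 * envelope T x) :=
    hM.convexOn_envelope.smul (by norm_num : (0 : ℝ) ≤ 2)
  refine ⟨fun x ↦ 2 * envelope T x, ⟨(hcont.const_mul 2).continuousOn, fun r _ ↦ hrat r,
    hconv.subset (Set.subset_univ _) (convex_Icc 0 1), fun x _ hx ↦
      ((hM.differentiableAt_envelope hx).const_mul 2).differentiableWithinAt⟩, fun G' hG' hr ↦ ?_⟩
  refine Set.EqOn.of_subset_closure (s := Set.Ioo 0 1 ∩ Set.range ((↑) : ℚ → ℝ)) ?_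
    (hcont.const_mul 2).continuousOn hG' (fun y hy ↦ Set.Ioo_subset_Icc_self hy.1) ?_
  · rintro _ ⟨hy, r, rfl⟩
    exact (hrat r).trans (hr r (Set.Ioo_subset_Icc_self hy)).symm
  · rw [← closure_Ioo (zero_ne_one (α := ℝ))]
    exact closure_minimal
      (Rat.denseRange_cast.open_subset_closure_inter isOpen_Ioo) isClosed_closure
end

section
/- Let (a,b,c) be a Markoff triple of reals and T a trace function for (a,b,c). Then the product over all pairs of coprime integers (p,q) with 0 < p < q of (T(p,q)²/(T(p,q)²−4))^q converges, and equals √(a²−4)·√(b²−4) / ((a − c·(b−√(b²−4))/2)·(b − c·(a−√(a²−4))/2)). -/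
namespace MarkoffProduct

noncomputable section

/-- The larger root `(x + √(x² − 4)) / 2` of `t² − x t + 1`. -/
def lam (x : ℝ) : ℝ := (x + √(x ^ 2 - 4)) / 2

/-- The leading coefficient of the sequence `y₀ = y`, `y₋₁ = z`, `yₙ₊₁ = x yₙ − yₙ₋₁`,
written as `α λⁿ + β λ⁻ⁿ` with `λ = lam x`. -/
def alpha (x y z : ℝ) : ℝ := (lam x * y - z) / √(x ^ 2 - 4)

/-- The logarithm of the weighted product over the open cone spanned by two vectors of weights
`m`, `n` and traces `x`, `y`, whose difference has trace `z`. -/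
def pot (m n x y z : ℝ) : ℝ :=
  m * (Real.log (lam y) - Real.log (alpha x y z)) +
    n * (Real.log (lam x) - Real.log (alpha y x z))

/-- The logarithm of the factor attached to the trace `x`. -/
def logFactor (x : ℝ) : ℝ := Real.log (x ^ 2 / (x ^ 2 - 4))

/-- A Markoff triple of reals. -/
structure Triple (x y z : ℝ) : Prop where
  hx : 2 < x
  hy : 2 < y
  hz : 2 < z
  eq : x ^ 2 + y ^ 2 + z ^ 2 = x * y * z

lemma Triple.swap {x y z : ℝ} (h : Triple x y z) : Triple y x z :=
  ⟨h.hy, h.hx, h.hz, by linarith [h.eq]⟩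

lemma Triple.flip {x y z : ℝ} (h : Triple x y z) : Triple x y (x * y - z) := by
  obtain ⟨hx, hy, hz, he⟩ := h
  have hpos : 0 < x * y - z := by
    have h1 : z * (x * y - z) = x ^ 2 + y ^ 2 := by linarith
    have h2 : 0 < z * (x * y - z) := by rw [h1]; positivity
    exact pos_of_mul_pos_right h2 (by linarith)
  refine ⟨hx, hy, ?_, by linarith⟩
  by_contra! hle
  have h3 : x ^ 2 + y ^ 2 + (x * y - z) ^ 2 = x * y * (x * y - z) := by linarith
  have h4 : x * y * (x * y - z) ≤ x * y * 2 := by gcongr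
  have h5 : 0 < (x * y - z) ^ 2 := by positivity
  nlinarith [sq_nonneg (x - y)]

lemma Triple.left {x y z : ℝ} (h : Triple x y z) : Triple x (x * y - z) y := by
  obtain ⟨hx, hy, hz, he⟩ := h.flip
  exact ⟨hx, hz, hy, by linarith⟩

lemma Triple.right {x y z : ℝ} (h : Triple x y z) : Triple (x * y - z) y x := by
  obtain ⟨hx, hy, hz, he⟩ := h.flip
  exact ⟨hz, hy, hx, by linarith⟩

lemma sqrt_pos {x : ℝ} (hx : 2 < x) : 0 < √(x ^ 2 - 4) := Real.sqrt_pos.2 (by nlinarith)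

lemma sq_sqrt {x : ℝ} (hx : 2 < x) : √(x ^ 2 - 4) ^ 2 = x ^ 2 - 4 := Real.sq_sqrt (by nlinarith)

lemma lam_gt {x : ℝ} (hx : 2 < x) : 1 < lam x := by
  have := sqrt_pos hx
  unfold lam; linarith

lemma half_lt_lam {x : ℝ} (hx : 2 < x) : x / 2 < lam x := by
  have := sqrt_pos hx
  unfold lam; linarith

lemma lam_sq {x : ℝ} (hx : 2 < x) : lam x ^ 2 = x * lam x - 1 := by
  have := sq_sqrt hx
  unfold lam; nlinarith

lemma lam_lt {x : ℝ} (hx : 2 < x) : lam x < x := by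
  have := lam_sq hx
  have := lam_gt hx
  nlinarith

lemma alpha_mul {x y z : ℝ} (h : Triple x y z) :
    alpha x y z * (y - alpha x y z) = x ^ 2 / (x ^ 2 - 4) := by
  have hs := sqrt_pos h.hx
  have hq := sq_sqrt h.hx
  rw [← hq]
  unfold alpha lam
  field_simp
  have he := h.eq
  linear_combination (y ^ 2) * hq - 4 * he

lemma one_lt_factor {x : ℝ} (hx : 2 < x) : 1 < x ^ 2 / (x ^ 2 - 4) := by
  rw [one_lt_div (by nlinarith)]; linarith

lemma alpha_pos {x y z : ℝ} (h : Triple x y z) : 0 < alpha x y z := by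
  have h1 := alpha_mul h
  have h2 := one_lt_factor h.hx
  by_contra! hle
  nlinarith [h.hy]

lemma alpha_le_lam {x y z : ℝ} (h : Triple x y z) : alpha x y z ≤ lam y := by
  have h1 := alpha_mul h
  have h2 := one_lt_factor h.hx
  have h3 := lam_sq h.hy
  have h4 := half_lt_lam h.hy
  by_contra! hlt
  nlinarith

lemma one_le_lam_mul_alpha {x y z : ℝ} (h : Triple x y z) : 1 ≤ lam y * alpha x y z := by
  have h1 := alpha_mul h
  have h2 := one_lt_factor h.hx
  have h3 := lam_sq h.hy
  have h4 := alpha_le_lam h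
  have h5 := alpha_pos h
  have h6 := lam_gt h.hy
  by_contra! hlt
  nlinarith

lemma alpha_next {x y z : ℝ} (hx : 2 < x) : alpha x (x * y - z) y = lam x * alpha x y z := by
  unfold alpha
  rw [← mul_div_assoc]
  congr 1
  linear_combination (-y) * lam_sq hx

lemma alpha_mul_alpha {x y z : ℝ} (h : Triple x y z) :
    alpha z x y * alpha z y x = lam z * (z ^ 2 / (z ^ 2 - 4)) := by
  have ht : Triple z x y := ⟨h.hz, h.hx, h.hy, by linarith [h.eq]⟩
  rw [← alpha_mul ht]
  have hs := sqrt_pos h.hz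
  have hq := sq_sqrt h.hz
  have : alpha z y x = lam z * (x - alpha z x y) := by
    unfold alpha lam
    field_simp
    linear_combination (-x) * hq
  rw [this]; ring

lemma log_alpha_add {x y z : ℝ} (h : Triple x y z) :
    Real.log (alpha z x y) + Real.log (alpha z y x) = Real.log (lam z) + logFactor z := by
  have h1 : Triple z x y := ⟨h.hz, h.hx, h.hy, by linarith [h.eq]⟩
  have h2 : Triple z y x := ⟨h.hz, h.hy, h.hx, by linarith [h.eq]⟩
  have h3 := lam_gt h.hz
  have h4 := one_lt_factor h.hz
  rw [logFactor, ← Real.log_mul (alpha_pos h1).ne' (alpha_pos h2).ne', alpha_mul_alpha h,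
    Real.log_mul (by positivity) (by positivity)]

lemma log_alpha_next {x y z : ℝ} (h : Triple x y z) :
    Real.log (alpha x (x * y - z) y) = Real.log (lam x) + Real.log (alpha x y z) := by
  have h3 := lam_gt h.hx
  rw [alpha_next h.hx, Real.log_mul (by positivity) (alpha_pos h).ne']

lemma pot_split (m n : ℝ) {x y z : ℝ} (h : Triple x y z) :
    pot m n x y z = (m + n) * logFactor (x * y - z) + pot m (m + n) x (x * y - z) y +
      pot (m + n) n (x * y - z) y x := by
  have h1 := log_alpha_add h.flip
  have h2 := log_alpha_next h
  have h3 := log_alpha_next h.swap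
  rw [mul_comm y x] at h3
  unfold pot
  linear_combination (m + n) * h1 + m * h2 + n * h3

lemma log_sub_nonneg {x y z : ℝ} (h : Triple x y z) :
    0 ≤ Real.log (lam y) - Real.log (alpha x y z) :=
  sub_nonneg.2 (Real.log_le_log (alpha_pos h) (alpha_le_lam h))

lemma pot_nonneg {m n x y z : ℝ} (hm : 0 ≤ m) (hn : 0 ≤ n) (h : Triple x y z) :
    0 ≤ pot m n x y z :=
  add_nonneg (mul_nonneg hm (log_sub_nonneg h)) (mul_nonneg hn (log_sub_nonneg h.swap))

lemma logFactor_pos {x : ℝ} (hx : 2 < x) : 0 < logFactor x := Real.log_pos (one_lt_factor hx)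

lemma le_logFactor {x : ℝ} (hx : 2 < x) : 4 / x ^ 2 ≤ logFactor x := by
  have h4 : 0 < x ^ 2 - 4 := by nlinarith
  have h := Real.one_sub_inv_le_log_of_pos (zero_lt_one.trans (one_lt_factor hx))
  have : 4 / x ^ 2 = 1 - (x ^ 2 / (x ^ 2 - 4))⁻¹ := by
    field_simp
    ring
  rw [this]
  exact h

lemma log_sub_le_of_le {k x y z : ℝ} (h : Triple x y z) (hk : 0 < k) (hk1 : k ≤ 1)
    (hx : k * x ^ 2 ≤ x ^ 2 - 4) (hy : k * y ^ 2 ≤ y ^ 2 - 4) (hz : z ≤ x * y - z) :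
    Real.log (lam y) - Real.log (alpha x y z) ≤ 4 / k ^ 2 * logFactor (x * y - z) := by
  have ha := alpha_pos h
  have hl := lam_gt h.hy
  have h2x := h.hx
  have h2y := h.hy
  have hs := sqrt_pos h2x
  have hx4 : 0 < x ^ 2 - 4 := by nlinarith
  have hhalf : y / 2 ≤ alpha x y z := by
    unfold alpha lam
    rw [le_div_iff₀ hs]
    nlinarith
  have hsy : k * y ≤ √(y ^ 2 - 4) := by
    apply Real.le_sqrt_of_sq_le
    have : k * y ^ 2 * k ≤ k * y ^ 2 * 1 := by gcongr
    nlinarith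
  have hprod : (lam y - alpha x y z) * (lam y + alpha x y z - y) = 4 / (x ^ 2 - 4) := by
    have e : x ^ 2 / (x ^ 2 - 4) = 1 + 4 / (x ^ 2 - 4) := by field_simp; ring
    linear_combination lam_sq h2y + alpha_mul h + e
  have hsum : k * y / 2 ≤ lam y + alpha x y z - y := by
    have : lam y = (y + √(y ^ 2 - 4)) / 2 := rfl
    linarith
  have hky : 0 < k * y := by positivity
  have hdiff : lam y - alpha x y z ≤ 8 / (k ^ 2 * x ^ 2 * y) := by
    have h0 := sub_nonneg.2 (alpha_le_lam h)
    have h1 : (lam y - alpha x y z) * (k * y / 2) ≤ 4 / (k * x ^ 2) := by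
      calc _ ≤ 4 / (x ^ 2 - 4) := by rw [← hprod]; gcongr
        _ ≤ 4 / (k * x ^ 2) := by gcongr
    have h2 : (8 : ℝ) / (k ^ 2 * x ^ 2 * y) = 4 / (k * x ^ 2) / (k * y / 2) := by
      field_simp
      norm_num
    rw [h2, le_div_iff₀ (by positivity)]
    exact h1
  have hlog : Real.log (lam y) - Real.log (alpha x y z) ≤
      (lam y - alpha x y z) / alpha x y z := by
    rw [← Real.log_div (by positivity) ha.ne', sub_div, div_self ha.ne']
    exact Real.log_le_sub_one_of_pos (by positivity)
  have hzz : 0 < x * y - z := by linarith [h.flip.hz]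
  calc _ ≤ (lam y - alpha x y z) / alpha x y z := hlog
    _ ≤ 8 / (k ^ 2 * x ^ 2 * y) / (y / 2) := by gcongr
    _ = 16 / k ^ 2 / (x * y) ^ 2 := by field_simp; norm_num
    _ ≤ 16 / k ^ 2 / (x * y - z) ^ 2 := by
        gcongr
        linarith [h.hz]
    _ = 4 / k ^ 2 * (4 / (x * y - z) ^ 2) := by ring
    _ ≤ _ := by
        gcongr
        exact le_logFactor h.flip.hz

lemma log_sub_le_of_bounded {M x y z : ℝ} (h : Triple x y z) (hy : y ≤ M)
    (hz : x * y - z ≤ M) :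
    Real.log (lam y) - Real.log (alpha x y z) ≤
      Real.log M * M ^ 2 / 2 * logFactor (x * y - z) := by
  have ha := alpha_pos h
  have hl := lam_gt h.hy
  have h2y := h.hy
  have h2z := h.flip.hz
  have hM : 0 < M := by linarith
  have h1 : Real.log (lam y) ≤ Real.log M :=
    Real.log_le_log (by positivity) (by linarith [lam_lt h2y])
  have h2 : 0 ≤ Real.log (lam y) + Real.log (alpha x y z) := by
    rw [← Real.log_mul (by positivity) ha.ne']
    exact Real.log_nonneg (one_le_lam_mul_alpha h)
  have hlM : 0 ≤ Real.log M := Real.log_nonneg (by linarith)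
  have h3 : 4 / M ^ 2 ≤ logFactor (x * y - z) :=
    le_trans (by gcongr) (le_logFactor h2z)
  calc _ ≤ 2 * Real.log M := by linarith
    _ = Real.log M * M ^ 2 / 2 * (4 / M ^ 2) := by field_simp; ring
    _ ≤ _ := by gcongr

/-- The hypotheses on a pair of weighted traces that are inherited by the two subcones. -/
structure Bounds (k M P m n x y z : ℝ) : Prop where
  triple : Triple x y z
  hm : 1 ≤ m
  hn : 1 ≤ n
  kx : k * x ^ 2 ≤ x ^ 2 - 4
  ky : k * y ^ 2 ≤ y ^ 2 - 4
  pot_le : pot m n x y z ≤ P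
  cases : z ≤ x * y - z ∨ (x ≤ M ∧ y ≤ M ∧ z ≤ M ∧ x * y - z ≤ M)

section Bounds

variable {k M P m n x y z : ℝ}

lemma Bounds.swap (h : Bounds k M P m n x y z) : Bounds k M P n m y x z where
  triple := h.triple.swap
  hm := h.hn
  hn := h.hm
  kx := h.ky
  ky := h.kx
  pot_le := by
    have := h.pot_le
    unfold pot at *
    linarith
  cases := by
    rw [mul_comm y x]
    have := h.cases
    tauto

lemma Bounds.left (hk : k ≤ Real.exp (-P)) (h : Bounds k M P m n x y z) :
    Bounds k M P m (m + n) x (x * y - z) y := by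
  have ht := h.triple
  have hx := ht.hx
  have hy := ht.hy
  have hm := h.hm
  have hn := h.hn
  have hz' := ht.flip.hz
  have hsplit := pot_split m n ht
  have h1 := pot_nonneg (m := m) (n := m + n) (by linarith) (by linarith) ht.left
  have h2 := pot_nonneg (m := m + n) (n := n) (by linarith) (by linarith) ht.right
  have h3 := logFactor_pos hz'
  have hP := h.pot_le
  refine ⟨ht.left, hm, by linarith, h.kx, ?_, by nlinarith, ?_⟩
  · have h4 : logFactor (x * y - z) ≤ P := by nlinarith
    have h5 : 0 < (x * y - z) ^ 2 - 4 := by nlinarith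
    rw [logFactor, Real.log_le_iff_le_exp (by positivity), div_le_iff₀ h5] at h4
    calc k * (x * y - z) ^ 2 ≤ Real.exp (-P) * (x * y - z) ^ 2 := by gcongr
      _ ≤ Real.exp (-P) * (Real.exp P * ((x * y - z) ^ 2 - 4)) := by gcongr
      _ = (x * y - z) ^ 2 - 4 := by
        rw [← mul_assoc, ← Real.exp_add]; simp
  · rcases le_or_gt y (x * (x * y - z) - y) with hgood | hbad
    · exact Or.inl hgood
    · rcases h.cases with hc | ⟨h6, h7, h8, h9⟩
      · left
        have : x * y ≤ 2 * (x * y - z) := by linarith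
        nlinarith
      · exact Or.inr ⟨h6, h9, h7, by linarith⟩

lemma Bounds.right (hk : k ≤ Real.exp (-P)) (h : Bounds k M P m n x y z) :
    Bounds k M P (m + n) n (x * y - z) y x := by
  have := (h.swap.left hk).swap
  rwa [mul_comm y x, add_comm n m] at this

lemma Bounds.pot_le_mul (hk : 0 < k) (hk1 : k ≤ 1) (hM : 1 ≤ M) (h : Bounds k M P m n x y z) :
    pot m n x y z ≤
      (4 / k ^ 2 + Real.log M * M ^ 2 / 2) * ((m + n) * logFactor (x * y - z)) := by
  have hm := h.hm
  have hn := h.hn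
  have hf := logFactor_pos h.triple.flip.hz
  have hlM : 0 ≤ Real.log M := Real.log_nonneg hM
  have key : ∀ {m n x y z : ℝ}, Bounds k M P m n x y z →
      Real.log (lam y) - Real.log (alpha x y z) ≤
        (4 / k ^ 2 + Real.log M * M ^ 2 / 2) * logFactor (x * y - z) := by
    intro m n x y z h
    have hf := logFactor_pos h.triple.flip.hz
    have e1 : 0 ≤ 4 / k ^ 2 * logFactor (x * y - z) := by positivity
    have e2 : 0 ≤ Real.log M * M ^ 2 / 2 * logFactor (x * y - z) := by positivity
    rw [add_mul]
    rcases h.cases with hc | ⟨-, h7, -, h9⟩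
    · linarith [log_sub_le_of_le h.triple hk hk1 h.kx h.ky hc]
    · linarith [log_sub_le_of_bounded h.triple h7 h9]
  have k1 := key h
  have k2 := key h.swap
  rw [mul_comm y x] at k2
  unfold pot
  calc _ ≤ m * ((4 / k ^ 2 + Real.log M * M ^ 2 / 2) * logFactor (x * y - z)) +
        n * ((4 / k ^ 2 + Real.log M * M ^ 2 / 2) * logFactor (x * y - z)) := by gcongr
    _ = _ := by ring

end Bounds

/-- The determinant of two vectors of `ℤ²`. -/
def det (v w : ℤ × ℤ) : ℤ := v.1 * w.2 - v.2 * w.1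

/-- The first `N` levels of the Stern–Brocot tree between `v` and `w`. -/
def cone : ℕ → ℤ × ℤ → ℤ × ℤ → Finset (ℤ × ℤ)
  | 0, _, _ => ∅
  | N + 1, v, w => insert (v + w) (cone N v (v + w) ∪ cone N (v + w) w)

lemma det_pos_of_mem_cone {N : ℕ} {v w u : ℤ × ℤ} (h : det v w = 1) (hu : u ∈ cone N v w) :
    0 < det v u ∧ 0 < det u w ∧ IsCoprime u.1 u.2 := by
  induction N generalizing v w with
  | zero => simp [cone] at hu
  | succ N ih =>
    have h1 : det v (v + w) = 1 := by rw [← h]; simp [det]; ring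
    have h2 : det (v + w) w = 1 := by rw [← h]; simp [det]; ring
    simp only [cone, Finset.mem_insert, Finset.mem_union] at hu
    rcases hu with rfl | hu | hu
    · refine ⟨by omega, by omega, ⟨-v.2, v.1, ?_⟩⟩
      rw [← h1, det]; ring
    · obtain ⟨h3, h4, h5⟩ := ih h1 hu
      refine ⟨h3, ?_, h5⟩
      simp only [det, Prod.fst_add, Prod.snd_add] at *
      linarith
    · obtain ⟨h3, h4, h5⟩ := ih h2 hu
      refine ⟨?_, h4, h5⟩
      simp only [det, Prod.fst_add, Prod.snd_add] at *
      linarith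

lemma mem_cone {N : ℕ} {v w u : ℤ × ℤ} (h : det v w = 1) (hu : IsCoprime u.1 u.2)
    (h1 : 0 < det v u) (h2 : 0 < det u w) (hN : det v u + det u w ≤ N + 1) : u ∈ cone N v w := by
  induction N generalizing v w with
  | zero => push_cast at hN; omega
  | succ N ih =>
    have hv : det v (v + w) = 1 := by rw [← h]; simp [det]; ring
    have hw : det (v + w) w = 1 := by rw [← h]; simp [det]; ring
    have e1 : det u (v + w) = det u w - det v u := by simp [det]; ring
    have e2 : det (v + w) u = det v u - det u w := by simp [det]; ring
    push_cast at hN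
    simp only [cone, Finset.mem_insert, Finset.mem_union]
    rcases lt_trichotomy (det v u) (det u w) with hlt | heq | hgt
    · exact Or.inr (Or.inl (ih hv h1 (by omega) (by omega)))
    · left
      have c1 : u.1 = det u w * (v.1 + w.1) := by
        have : u.1 = det u w * v.1 + det v u * w.1 := by
          simp only [det] at h ⊢
          linear_combination (-u.1) * h
        rw [this, heq]; ring
      have c2 : u.2 = det u w * (v.2 + w.2) := by
        have : u.2 = det u w * v.2 + det v u * w.2 := by
          simp only [det] at h ⊢
          linear_combination (-u.2) * h
        rw [this, heq]; ring
      have hunit : IsUnit (det u w) :=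
        hu.isUnit_of_dvd' ⟨_, c1⟩ ⟨_, c2⟩
      have hone : det u w = 1 := by
        rcases Int.isUnit_iff.1 hunit with h' | h' <;> omega
      rw [hone, one_mul] at c1 c2
      exact Prod.ext c1 c2
    · exact Or.inr (Or.inr (ih hw (by omega) h2 (by omega)))

lemma sum_cone_succ {N : ℕ} {v w : ℤ × ℤ} (h : det v w = 1) (g : ℤ × ℤ → ℝ) :
    ∑ u ∈ cone (N + 1) v w, g u =
      g (v + w) + (∑ u ∈ cone N v (v + w), g u + ∑ u ∈ cone N (v + w) w, g u) := by
  have hv : det v (v + w) = 1 := by rw [← h]; simp [det]; ring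
  have hw : det (v + w) w = 1 := by rw [← h]; simp [det]; ring
  have hself : det (v + w) (v + w) = 0 := by simp [det]; ring
  rw [cone, Finset.sum_insert, Finset.sum_union]
  · rw [Finset.disjoint_left]
    intro u hu hu'
    have h1 := (det_pos_of_mem_cone hv hu).2.1
    have h2 := (det_pos_of_mem_cone hw hu').1
    simp only [det] at h1 h2
    linarith
  · rw [Finset.mem_union, not_or]
    exact ⟨fun hu => by have := (det_pos_of_mem_cone hv hu).2.1; omega,
      fun hu => by have := (det_pos_of_mem_cone hw hu).1; omega⟩

section Trace

variable {a b c : ℝ} {T : ℤ × ℤ → ℝ}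

lemma trace_add (hT : IsTraceFunction a b c T) {v w : ℤ × ℤ} (h : det v w = 1) :
    T (v + w) = T v * T w - T (v - w) := by
  unfold det at h
  exact hT.add_rule v w ⟨w.2, -w.1, by linarith⟩ ⟨-v.2, v.1, by linarith⟩ (Or.inl h)

lemma trace_sub_left (hT : IsTraceFunction a b c T) {v w : ℤ × ℤ} (h : det v w = 1) :
    T (v - (v + w)) = T w := by
  unfold det at h
  rw [sub_add_cancel_left]
  exact hT.neg_eq w ⟨-v.2, v.1, by linarith⟩

/-- The logarithm of the factor attached to the vector `u`. -/
def term (T : ℤ × ℤ → ℝ) (u : ℤ × ℤ) : ℝ := u.2 * logFactor (T u)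

lemma pot_sub_sum_cone_bounds (hT : IsTraceFunction a b c T) {k M P : ℝ} (hk : 0 < k) (hk1 : k ≤ 1)
    (hM : 1 ≤ M) (hkP : k ≤ Real.exp (-P)) (N : ℕ) {v w : ℤ × ℤ} (h : det v w = 1)
    (hB : Bounds k M P v.2 w.2 (T v) (T w) (T (v - w))) :
    0 ≤ pot v.2 w.2 (T v) (T w) (T (v - w)) - ∑ u ∈ cone N v w, term T u ∧
      pot v.2 w.2 (T v) (T w) (T (v - w)) - ∑ u ∈ cone N v w, term T u ≤
        (1 - (4 / k ^ 2 + Real.log M * M ^ 2 / 2)⁻¹) ^ N *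
          pot v.2 w.2 (T v) (T w) (T (v - w)) := by
  have hm := hB.hm
  have hn := hB.hn
  set C := 4 / k ^ 2 + Real.log M * M ^ 2 / 2 with hC
  have hC1 : 1 ≤ C := by
    have hlM : 0 ≤ Real.log M := Real.log_nonneg hM
    have : 1 ≤ 4 / k ^ 2 := by
      rw [le_div_iff₀ (by positivity)]
      nlinarith
    have : 0 ≤ Real.log M * M ^ 2 / 2 := by positivity
    linarith
  induction N generalizing v w with
  | zero => simpa [cone] using pot_nonneg (by linarith) (by linarith) hB.triple
  | succ N ih =>
    have hv : det v (v + w) = 1 := by rw [← h]; simp [det]; ring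
    have hw : det (v + w) w = 1 := by rw [← h]; simp [det]; ring
    have hadd := trace_add hT h
    have hbv := hB.left hkP
    have hbw := hB.right hkP
    have hsplit := pot_split (v.2 : ℝ) w.2 hB.triple
    have hle := hB.pot_le_mul hk hk1 hM
    rw [← hC] at hle
    have hsnd : ((v + w).2 : ℝ) = v.2 + w.2 := by simp
    have hterm : term T (v + w) = (v.2 + w.2) * logFactor (T (v + w)) := by rw [term, hsnd]
    rw [← hadd, ← hsnd] at hbv hbw
    rw [← hadd, ← hterm, ← hsnd] at hsplit
    rw [← hadd, ← hterm] at hle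
    have iv := ih hv (by rwa [trace_sub_left hT h]) hbv.hm hbv.hn
    have iw := ih hw (by rwa [add_sub_cancel_right]) hbw.hm hbw.hn
    rw [trace_sub_left hT h] at iv
    rw [add_sub_cancel_right] at iw
    rw [sum_cone_succ h]
    refine ⟨by linarith [iv.1, iw.1], ?_⟩
    have hρ : 0 ≤ 1 - C⁻¹ := sub_nonneg.2 (inv_le_one_of_one_le₀ hC1)
    have hdec : pot v.2 w.2 (T v) (T w) (T (v - w)) - term T (v + w) ≤
        (1 - C⁻¹) * pot v.2 w.2 (T v) (T w) (T (v - w)) := by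
      have : C⁻¹ * pot v.2 w.2 (T v) (T w) (T (v - w)) ≤ term T (v + w) := by
        rw [inv_mul_le_iff₀ (by linarith)]
        exact hle
      linarith
    calc _ ≤ (1 - C⁻¹) ^ N *
          (pot v.2 w.2 (T v) (T w) (T (v - w)) - term T (v + w)) := by
            linarith [iv.2, iw.2, congrArg (fun t => (1 - C⁻¹) ^ N * t) hsplit]
      _ ≤ (1 - C⁻¹) ^ N * ((1 - C⁻¹) * pot v.2 w.2 (T v) (T w) (T (v - w))) := by gcongr
      _ = _ := by ring

end Trace

lemma exists_bounds {x y z : ℝ} (h : Triple x y z) :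
    ∃ k M P : ℝ, 0 < k ∧ k ≤ 1 ∧ 1 ≤ M ∧ k ≤ Real.exp (-P) ∧ Bounds k M P 1 1 x y z := by
  have hx := h.hx
  have hy := h.hy
  have hz := h.hz
  have hz' := h.flip.hz
  have hx4 : 0 < x ^ 2 - 4 := by nlinarith
  have hy4 : 0 < y ^ 2 - 4 := by nlinarith
  set P := pot 1 1 x y z
  set k := min (Real.exp (-P)) (min ((x ^ 2 - 4) / x ^ 2) ((y ^ 2 - 4) / y ^ 2)) with hk
  have kx : k ≤ (x ^ 2 - 4) / x ^ 2 := (min_le_right _ _).trans (min_le_left _ _)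
  have ky : k ≤ (y ^ 2 - 4) / y ^ 2 := (min_le_right _ _).trans (min_le_right _ _)
  refine ⟨k, x + y + z + (x * y - z), P, by rw [hk]; positivity, ?_, by linarith,
    min_le_left _ _, h, le_rfl, le_rfl, ?_, ?_, le_rfl, Or.inr ⟨?_, ?_, ?_, ?_⟩⟩
  · refine kx.trans ?_
    rw [div_le_one (by positivity)]
    linarith
  · rwa [← le_div_iff₀ (by positivity)]
  · rwa [← le_div_iff₀ (by positivity)]
  all_goals linarith

/-- The vectors `(p, q)` with `p`, `q` coprime and `0 < p < q`. -/
abbrev Index : Type := {v : ℤ × ℤ // 0 < v.1 ∧ v.1 < v.2 ∧ IsCoprime v.1 v.2}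

lemma mem_cone_index {N : ℕ} {u : ℤ × ℤ} (hu : u ∈ cone N (1, 1) (0, 1)) :
    0 < u.1 ∧ u.1 < u.2 ∧ IsCoprime u.1 u.2 := by
  obtain ⟨h1, h2, h3⟩ := det_pos_of_mem_cone (by simp [det]) hu
  simp only [det] at h1 h2
  exact ⟨by omega, by omega, h3⟩

lemma index_mem_cone (u : Index) : u.val ∈ cone u.val.2.toNat (1, 1) (0, 1) := by
  obtain ⟨u, h1, h2, h3⟩ := u
  refine mem_cone (by simp [det]) h3 ?_ ?_ ?_ <;> simp only [det] <;> omega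

lemma cone_mono {M N : ℕ} (h : M ≤ N) (v w : ℤ × ℤ) : cone M v w ⊆ cone N v w := by
  induction M generalizing N v w with
  | zero => simp [cone]
  | succ M ih =>
    obtain ⟨N, rfl⟩ : ∃ K, N = K + 1 := ⟨N - 1, by omega⟩
    exact Finset.insert_subset_insert _
      (Finset.union_subset_union (ih (by omega) _ _) (ih (by omega) _ _))

/-- A function on coprime pairs is summed by exhausting the Stern–Brocot tree. -/
lemma hasSum_of_tendsto_cone {g : ℤ × ℤ → ℝ} {S : ℝ} (hg : ∀ u : Index, 0 ≤ g u.val)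
    (h : Filter.Tendsto (fun N => ∑ u ∈ cone N (1, 1) (0, 1), g u) Filter.atTop (nhds S)) :
    HasSum (fun u : Index => g u.val) S := by
  classical
  have hsub : ∀ N, ∑ u ∈ (cone N (1, 1) (0, 1)).subtype
      (fun v => 0 < v.1 ∧ v.1 < v.2 ∧ IsCoprime v.1 v.2), g u.val =
        ∑ u ∈ cone N (1, 1) (0, 1), g u := fun N =>
    Finset.sum_subtype_of_mem g fun _ hu => mem_cone_index hu
  have hmono : Monotone fun N => ∑ u ∈ cone N (1, 1) (0, 1), g u := fun M N hMN =>
    Finset.sum_le_sum_of_subset_of_nonneg (cone_mono hMN _ _)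
      fun u hu _ => hg ⟨u, mem_cone_index hu⟩
  refine hasSum_of_isLUB_of_nonneg _ hg ⟨?_, ?_⟩
  · rintro _ ⟨F, rfl⟩
    refine le_trans ?_ (hmono.ge_of_tendsto h (F.sup fun u => u.val.2.toNat))
    simp only
    rw [← hsub]
    refine Finset.sum_le_sum_of_subset_of_nonneg (fun u hu => ?_) fun u _ _ => hg u
    rw [Finset.mem_subtype]
    exact cone_mono (Finset.le_sup (f := fun u : Index => u.val.2.toNat) hu) _ _
      (index_mem_cone u)
  · intro B hB
    refine le_of_tendsto' h fun N => ?_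
    rw [← hsub]
    exact hB ⟨_, rfl⟩

lemma two_lt_of_mem_cone {a b c : ℝ} {T : ℤ × ℤ → ℝ} (hT : IsTraceFunction a b c T) {N : ℕ}
    {v w u : ℤ × ℤ} (h : det v w = 1) (ht : Triple (T v) (T w) (T (v - w)))
    (hu : u ∈ cone N v w) : 2 < T u := by
  induction N generalizing v w with
  | zero => simp [cone] at hu
  | succ N ih =>
    have hv : det v (v + w) = 1 := by rw [← h]; simp [det]; ring
    have hw : det (v + w) w = 1 := by rw [← h]; simp [det]; ring
    have hadd := trace_add hT h
    simp only [cone, Finset.mem_insert, Finset.mem_union] at hu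
    rcases hu with rfl | hu | hu
    · rw [hadd]; exact ht.flip.hz
    · refine ih hv ?_ hu
      rw [trace_sub_left hT h, hadd]
      exact ht.left
    · refine ih hw ?_ hu
      rw [add_sub_cancel_right, hadd]
      exact ht.right

lemma exp_pot_one {x y z : ℝ} (h : Triple x y z) :
    Real.exp (pot 1 1 x y z) = √(y ^ 2 - 4) * √(x ^ 2 - 4) /
      ((y - z * (x - √(x ^ 2 - 4)) / 2) * (x - z * (y - √(y ^ 2 - 4)) / 2)) := by
  have h1 := alpha_pos h
  have h2 := alpha_pos h.swap
  have lx := lam_gt h.hx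
  have ly := lam_gt h.hy
  have hsx := sqrt_pos h.hx
  have hsy := sqrt_pos h.hy
  have ex : ∀ {x y : ℝ}, 2 < x →
      alpha x y z = lam x * (y - z * (x - √(x ^ 2 - 4)) / 2) / √(x ^ 2 - 4) := by
    intro x y hx
    have := sq_sqrt hx
    unfold alpha lam
    congr 1
    linear_combination (-z / 4) * this
  have e1 := ex (y := y) h.hx
  have e2 := ex (y := x) h.hy
  rw [pot, one_mul, one_mul, Real.exp_add, Real.exp_sub, Real.exp_sub,
    Real.exp_log (zero_lt_one.trans lx), Real.exp_log (zero_lt_one.trans ly),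
    Real.exp_log h1, Real.exp_log h2]
  have n1 : y - z * (x - √(x ^ 2 - 4)) / 2 ≠ 0 := by
    intro h0
    rw [h0, mul_zero, zero_div] at e1
    exact h1.ne' e1
  have n2 : x - z * (y - √(y ^ 2 - 4)) / 2 ≠ 0 := by
    intro h0
    rw [h0, mul_zero, zero_div] at e2
    exact h2.ne' e2
  rw [e1, e2]
  generalize y - z * (x - √(x ^ 2 - 4)) / 2 = A at n1 ⊢
  generalize x - z * (y - √(y ^ 2 - 4)) / 2 = B at n2 ⊢
  field_simp

end

end MarkoffProduct

open MarkoffProduct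

/-- For a Markoff triple of reals `(a,b,c)` with trace function `T`, the product over
all coprime pairs `(p,q)` with `0 < p < q` of `(T(p,q)²/(T(p,q)²−4))^q` converges to
`√(a²−4)·√(b²−4) / ((a − c·(b−√(b²−4))/2)·(b − c·(a−√(a²−4))/2))`. -/
theorem partial_product_identity (a b c : ℝ) (ha : 2 < a) (hb : 2 < b) (hc : 2 < c)
    (habc : a ^ 2 + b ^ 2 + c ^ 2 = a * b * c)
    (T : ℤ × ℤ → ℝ) (hT : IsTraceFunction a b c T) :
    HasProd
      (fun v : {v : ℤ × ℤ // 0 < v.1 ∧ v.1 < v.2 ∧ IsCoprime v.1 v.2} =>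
        (T v.val ^ 2 / (T v.val ^ 2 - 4)) ^ (v.val.2 : ℤ))
      (Real.sqrt (a ^ 2 - 4) * Real.sqrt (b ^ 2 - 4) /
        ((a - c * (b - Real.sqrt (b ^ 2 - 4)) / 2) *
          (b - c * (a - Real.sqrt (a ^ 2 - 4)) / 2))) := by
  have ht : Triple b a c := ⟨hb, ha, hc, by linarith⟩
  have hdet : det (1, 1) (0, 1) = 1 := by simp [det]
  have hsub : ((1, 1) : ℤ × ℤ) - (0, 1) = (1, 0) := rfl
  have htT : Triple (T (1, 1)) (T (0, 1)) (T ((1, 1) - (0, 1))) := by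
    rw [hsub, hT.map_11, hT.map_01, hT.map_10]
    exact ht
  have htwo : ∀ u : Index, 2 < T u.val := fun u =>
    two_lt_of_mem_cone hT hdet htT (index_mem_cone u)
  obtain ⟨k, M, P, hk, hk1, hM, hkP, hB⟩ := exists_bounds ht
  have hsum : HasSum (fun u : Index => term T u.val) (pot 1 1 b a c) := by
    refine hasSum_of_tendsto_cone (fun u => ?_) ?_
    · have h1 : (0 : ℝ) ≤ u.val.2 := by
        have := u.property
        exact_mod_cast (by omega : (0 : ℤ) ≤ u.val.2)
      exact mul_nonneg h1 (logFactor_pos (htwo u)).le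
    · have hbd := fun N => pot_sub_sum_cone_bounds hT hk hk1 hM hkP N hdet
        (by simpa [hsub, hT.map_11, hT.map_01, hT.map_10] using hB)
      simp only [hsub, hT.map_11, hT.map_01, hT.map_10, Int.cast_one] at hbd
      have hC : 1 ≤ 4 / k ^ 2 + Real.log M * M ^ 2 / 2 := by
        have hlM : 0 ≤ Real.log M := Real.log_nonneg hM
        have h4 : 1 ≤ 4 / k ^ 2 := by
          rw [le_div_iff₀ (by positivity)]
          nlinarith
        have : 0 ≤ Real.log M * M ^ 2 / 2 := by positivity
        linarith
      have hgeom := (tendsto_pow_atTop_nhds_zero_of_lt_one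
        (sub_nonneg.2 (inv_le_one_of_one_le₀ hC))
        (sub_lt_self 1 (inv_pos.2 (by linarith)))).mul_const (pot 1 1 b a c)
      rw [zero_mul] at hgeom
      have hz := squeeze_zero (fun N => (hbd N).1) (fun N => (hbd N).2) hgeom
      simpa using hz.const_sub (pot 1 1 b a c)
  have hprod := hsum.rexp
  rw [exp_pot_one ht] at hprod
  convert hprod using 1
  funext u
  have hpos := zero_lt_one.trans (one_lt_factor (htwo u))
  rw [Function.comp_apply, term, logFactor, mul_comm, Real.exp_mul, Real.exp_log hpos,
    Real.rpow_intCast]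
end

section
/- Let (a,b,c) be a Markoff triple of reals and T a trace function for (a,b,c). Then the product over all primitive vectors up to sign, i.e. over all pairs of coprime integers (p,q) with q > 0 together with (p,q) = (1,0), of (T(p,q)²/(T(p,q)²−4))^{h(p,q)} with h(p,q) = max(|p|, |q|, |p−q|), converges and equals ((a+√(a²−4))/2)·((b+√(b²−4))/2)·((c+√(c²−4))/2). -/
/-- The larger root of `X² - tX + 1`. -/
noncomputable def eigen (t : ℝ) : ℝ := (t + √(t ^ 2 - 4)) / 2

theorem eigen_mul_self {t : ℝ} (ht : 2 < t) : eigen t * eigen t = t * eigen t - 1 := by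
  have h : √(t ^ 2 - 4) ^ 2 = t ^ 2 - 4 := Real.sq_sqrt (by nlinarith)
  unfold eigen
  linear_combination h / 4

theorem one_lt_eigen {t : ℝ} (ht : 2 < t) : 1 < eigen t := by
  have := Real.sqrt_nonneg (t ^ 2 - 4)
  unfold eigen
  linarith

theorem eigen_add_inv {t : ℝ} (ht : 2 < t) : eigen t + (eigen t)⁻¹ = t := by
  have h0 : eigen t ≠ 0 := by linarith [one_lt_eigen ht]
  field_simp
  linear_combination eigen_mul_self ht

theorem eigen_sub_inv_sq {t : ℝ} (ht : 2 < t) :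
    (eigen t - (eigen t)⁻¹) ^ 2 = t ^ 2 - 4 := by
  have h0 : eigen t ≠ 0 := by linarith [one_lt_eigen ht]
  have h := eigen_add_inv ht
  have h1 : eigen t * (eigen t)⁻¹ = 1 := mul_inv_cancel₀ h0
  linear_combination (-4) * h1 + (t + eigen t + (eigen t)⁻¹) * h

theorem inv_eigen_lt {t : ℝ} (ht : 2 < t) : (eigen t)⁻¹ < eigen t :=
  (inv_lt_one_of_one_lt₀ (one_lt_eigen ht)).trans (one_lt_eigen ht)

/-- Markoff triples of reals greater than two. -/
structure MarkoffTriple (x y z : ℝ) : Prop where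
  two_lt_left : 2 < x
  two_lt_mid : 2 < y
  two_lt_right : 2 < z
  eq : x ^ 2 + y ^ 2 + z ^ 2 = x * y * z

namespace MarkoffTriple

variable {x y z : ℝ}

theorem rotate (h : MarkoffTriple x y z) : MarkoffTriple y z x :=
  ⟨h.2, h.3, h.1, by linear_combination h.4⟩

theorem swap (h : MarkoffTriple x y z) : MarkoffTriple y x z :=
  ⟨h.2, h.1, h.3, by linear_combination h.4⟩

theorem flip (h : MarkoffTriple x y z) : MarkoffTriple x z (x * z - y) := by
  obtain ⟨hx, hy, hz, h⟩ := h
  refine ⟨hx, hz, ?_, by linear_combination h⟩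
  have h1 : y * (x * z - y) = x ^ 2 + z ^ 2 := by linear_combination -h
  have h2 : 0 < x * z - y := by
    by_contra! h3
    nlinarith
  nlinarith [sq_nonneg (x - z), mul_pos (by linarith : 0 < x) (by linarith : 0 < z), sq_pos_of_pos h2]

end MarkoffTriple

/-- The coefficient `α` in `α λⁿ + β λ⁻ⁿ`, the sequence with values `y`, `z` at `n = 0, 1`, where
`λ = eigen x`. -/
noncomputable def leadCoeff (x y z : ℝ) : ℝ :=
  (z - y * (eigen x)⁻¹) / (eigen x - (eigen x)⁻¹)

/-- The coefficient of the height of the region with trace `x` in the sum over the branch behind the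
edge between the regions with traces `x` and `y`, whose far end has trace `z`. -/
noncomputable def gap (x y z : ℝ) : ℝ := Real.log (eigen y) - Real.log (leadCoeff x y z)

namespace MarkoffTriple

variable {x y z : ℝ}

theorem leadCoeff_mul (h : MarkoffTriple x y z) :
    leadCoeff x y z * (y - leadCoeff x y z) = x ^ 2 / (x ^ 2 - 4) := by
  have hx := h.1
  have h1 := eigen_sub_inv_sq hx
  have h2 := eigen_add_inv hx
  have h0 : eigen x ≠ 0 := by linarith [one_lt_eigen hx]
  have h4 : eigen x * (eigen x)⁻¹ = 1 := mul_inv_cancel₀ h0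
  have h3 := inv_eigen_lt hx
  have h5 := h.eq
  unfold leadCoeff
  rw [← h1]
  generalize (eigen x)⁻¹ = i at *
  generalize eigen x = l at *
  have h6 : l - i ≠ 0 := by linarith
  field_simp
  subst h2
  linear_combination (-h5) + (-y^2) * h4

theorem leadCoeff_pos (h : MarkoffTriple x y z) : 0 < leadCoeff x y z := by
  have h1 := h.leadCoeff_mul
  have hx := h.1
  have hy := h.2
  have h2 : 0 < x ^ 2 / (x ^ 2 - 4) := div_pos (by nlinarith) (by nlinarith)
  by_contra! h3
  nlinarith

theorem leadCoeff_flip (h : MarkoffTriple x y z) :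
    leadCoeff x z (x * z - y) = eigen x * leadCoeff x y z := by
  have hx := h.1
  have h2 := eigen_add_inv hx
  have h0 : eigen x ≠ 0 := by linarith [one_lt_eigen hx]
  have h4 : eigen x * (eigen x)⁻¹ = 1 := mul_inv_cancel₀ h0
  unfold leadCoeff
  rw [← mul_div_assoc]
  congr 1
  linear_combination y * h4 - z * h2

theorem leadCoeff_mul_leadCoeff (h : MarkoffTriple x y z) :
    leadCoeff z x (x * z - y) * leadCoeff z y (y * z - x) =
      eigen z * (z ^ 2 / (z ^ 2 - 4)) := by
  have hx := h.3
  have h1 := eigen_sub_inv_sq hx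
  have h2 := eigen_add_inv hx
  have h0 : eigen z ≠ 0 := by linarith [one_lt_eigen hx]
  have h4 : eigen z * (eigen z)⁻¹ = 1 := mul_inv_cancel₀ h0
  have h3 := inv_eigen_lt hx
  have h5 := h.eq
  unfold leadCoeff
  rw [← h1]
  generalize (eigen z)⁻¹ = i at *
  generalize eigen z = l at *
  have h6 : l - i ≠ 0 := by linarith
  field_simp
  subst h2
  linear_combination (-l) * h5 - x * y * h4

theorem gap_eq_gap_flip (h : MarkoffTriple x y z) :
    gap x y z = gap x z (x * z - y) +
      (Real.log (eigen x) + Real.log (eigen y) - Real.log (eigen z)) := by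
  have := h.leadCoeff_pos
  have := one_lt_eigen h.1
  unfold gap
  rw [h.leadCoeff_flip, Real.log_mul (by linarith) (by linarith)]
  ring

theorem log_add_gap_add_gap (h : MarkoffTriple x y z) :
    Real.log (z ^ 2 / (z ^ 2 - 4)) + gap z x (x * z - y) + gap z y (y * z - x) =
      Real.log (eigen x) + Real.log (eigen y) - Real.log (eigen z) := by
  have h1 := h.leadCoeff_mul_leadCoeff
  have hz := one_lt_eigen h.3
  have h2 : 0 < z ^ 2 / (z ^ 2 - 4) :=
    div_pos (by nlinarith [h.3]) (by nlinarith [h.3])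
  have e1 : MarkoffTriple z x (x * z - y) := h.flip.swap
  have e2 : MarkoffTriple z y (y * z - x) := h.swap.flip.swap
  have h3 := congrArg Real.log h1
  rw [Real.log_mul e1.leadCoeff_pos.ne' e2.leadCoeff_pos.ne',
    Real.log_mul (by linarith) h2.ne'] at h3
  unfold gap
  linarith

theorem gap_mem_Icc (h : MarkoffTriple x y z) (hz : x * y ≤ 2 * z) :
    gap x y z ∈ Set.Icc 0 (4 / (x ^ 2 - 4) * (4 / (y ^ 2 - 4))) := by
  have hx := h.1
  have hy := h.2
  have hm := h.leadCoeff_mul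
  have hp := h.leadCoeff_pos
  have hl := one_lt_eigen hy
  have hadd := eigen_add_inv hy
  have hsq := eigen_sub_inv_sq hy
  have hinv := inv_eigen_lt hy
  have hlx := inv_eigen_lt hx
  have h4 : eigen y * (eigen y)⁻¹ = 1 := mul_inv_cancel₀ (by linarith)
  have hge : y ≤ 2 * leadCoeff x y z := by
    unfold leadCoeff
    rw [← mul_div_assoc, le_div_iff₀ (by linarith)]
    have := eigen_add_inv hx
    nlinarith
  have hx4 : 0 < x ^ 2 - 4 := by nlinarith
  have hf : x ^ 2 / (x ^ 2 - 4) = 1 + 4 / (x ^ 2 - 4) := by field_simp; ring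
  have hg : 0 < 4 / (x ^ 2 - 4) := by positivity
  rw [hf] at hm
  have hlog : gap x y z = Real.log (eigen y / leadCoeff x y z) := by
    rw [Real.log_div (by linarith) hp.ne']; rfl
  rw [hlog]
  generalize leadCoeff x y z = α at *
  generalize (eigen y)⁻¹ = i at *
  generalize eigen y = l at *
  generalize 4 / (x ^ 2 - 4) = g at *
  rw [← hsq]
  have key : (l - α) * (α - i) = g := by
    subst hadd
    linear_combination hm - h4
  have hai : (l - i) / 2 ≤ α - i := by linarith
  have hla : 0 < l - α := by
    by_contra! h0
    nlinarith
  refine ⟨Real.log_nonneg ((one_le_div hp).2 (by linarith)), ?_⟩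
  refine (Real.log_le_sub_one_of_pos (div_pos (by linarith) hp)).trans ?_
  have hli : 0 < l - i := by linarith
  have e : l / α - 1 = g / (α * (α - i)) := by
    rw [← key]
    have : α - i ≠ 0 := by linarith
    field_simp
  rw [e, mul_div_assoc', div_le_div_iff₀ (by nlinarith) (by positivity)]
  have : (l - i) ^ 2 ≤ 4 * (α * (α - i)) := by
    have hi : 0 < i := by nlinarith
    nlinarith
  nlinarith

end MarkoffTriple

/-- Coprime pairs of positive integers. -/
def primPairs : Set (ℤ × ℤ) := {x | IsCoprime x.1 x.2 ∧ 0 < x.1 ∧ 0 < x.2}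

/-- An oriented basis of `ℤ²` whose traces form a Markoff triple. -/
structure IsEdge (T : ℤ × ℤ → ℝ) (u v : ℤ × ℤ) : Prop where
  det : u.1 * v.2 - u.2 * v.1 = 1
  markoff : MarkoffTriple (T u) (T v) (T (u + v))

/-- The linear height with values `p` and `q` on the basis vectors. -/
def height (p q : ℝ) (x : ℤ × ℤ) : ℝ := x.1 * p + x.2 * q

/-- The logarithm of the factor at `x.1 • u + x.2 • v`. -/
noncomputable def term (T : ℤ × ℤ → ℝ) (u v : ℤ × ℤ) (p q : ℝ) (x : ℤ × ℤ) : ℝ :=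
  height p q x *
    Real.log (T (x.1 • u + x.2 • v) ^ 2 / (T (x.1 • u + x.2 • v) ^ 2 - 4))

/-- The closed form of the sum of `term T u v p q` over `primPairs`. -/
noncomputable def edgeGap (T : ℤ × ℤ → ℝ) (u v : ℤ × ℤ) (p q : ℝ) : ℝ :=
  p * gap (T u) (T v) (T (u + v)) + q * gap (T v) (T u) (T (u + v))

theorem primitive_of_det {u v : ℤ × ℤ} (h : u.1 * v.2 - u.2 * v.1 = 1) :
    Primitive u ∧ Primitive v :=
  ⟨⟨v.2, -v.1, by linear_combination h⟩, ⟨-u.2, u.1, by linear_combination h⟩⟩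

section Edge

variable {a b c : ℝ} {T : ℤ × ℤ → ℝ} {u v : ℤ × ℤ} {p q : ℝ}

theorem IsTraceFunction.map_left (hT : IsTraceFunction a b c T)
    (h : u.1 * v.2 - u.2 * v.1 = 1) : T (u + (u + v)) = T u * T (u + v) - T v := by
  have hdet : u.1 * (u + v).2 - u.2 * (u + v).1 = 1 := by
    simp only [Prod.fst_add, Prod.snd_add]; linear_combination h
  have h1 := primitive_of_det hdet
  rw [hT.add_rule _ _ h1.1 h1.2 (Or.inl hdet), sub_add_cancel_left,
    hT.neg_eq _ (primitive_of_det h).2]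

theorem IsTraceFunction.map_right (hT : IsTraceFunction a b c T)
    (h : u.1 * v.2 - u.2 * v.1 = 1) : T (u + v + v) = T v * T (u + v) - T u := by
  have hdet : (u + v).1 * v.2 - (u + v).2 * v.1 = 1 := by
    simp only [Prod.fst_add, Prod.snd_add]; linear_combination h
  have h1 := primitive_of_det hdet
  rw [hT.add_rule _ _ h1.1 h1.2 (Or.inl hdet), add_sub_cancel_right, mul_comm]

theorem IsEdge.left (hT : IsTraceFunction a b c T) (h : IsEdge T u v) :
    IsEdge T u (u + v) := by
  refine ⟨?_, ?_⟩
  · simp only [Prod.fst_add, Prod.snd_add]; linear_combination h.det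
  · rw [hT.map_left h.det]; exact h.markoff.flip

theorem IsEdge.right (hT : IsTraceFunction a b c T) (h : IsEdge T u v) :
    IsEdge T (u + v) v := by
  refine ⟨?_, ?_⟩
  · simp only [Prod.fst_add, Prod.snd_add]; linear_combination h.det
  · rw [hT.map_right h.det]; exact h.markoff.swap.flip.swap

theorem IsTraceFunction.isEdge (hT : IsTraceFunction a b c T)
    (hdet : u.1 * v.2 - u.2 * v.1 = 1) (h : MarkoffTriple (T u) (T (u - v)) (T v)) :
    IsEdge T u v where
  det := hdet
  markoff := by
    have h1 := primitive_of_det hdet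
    rw [hT.add_rule _ _ h1.1 h1.2 (Or.inl hdet)]
    exact h.flip

theorem edgeGap_eq (hT : IsTraceFunction a b c T) (h : IsEdge T u v) :
    edgeGap T u v p q = (p + q) * Real.log (T (u + v) ^ 2 / (T (u + v) ^ 2 - 4)) +
      (edgeGap T u (u + v) p (p + q) + edgeGap T (u + v) v (p + q) q) := by
  have h1 := h.markoff.gap_eq_gap_flip
  have h2 := h.markoff.swap.gap_eq_gap_flip
  have h3 := h.markoff.log_add_gap_add_gap
  unfold edgeGap
  rw [hT.map_left h.det, hT.map_right h.det]
  linear_combination p * h1 + q * h2 - (p + q) * h3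

theorem hasSum_image_of_injective {f : ℤ × ℤ → ℝ} {φ : ℤ × ℤ → ℤ × ℤ}
    (hφ : Function.Injective φ) {s : Set (ℤ × ℤ)} {r : ℝ}
    (h : HasSum (fun x : s => f (φ x)) r) :
    HasSum (fun x : (φ '' s : Set (ℤ × ℤ)) => f x) r :=
  (Equiv.Set.image φ s hφ).hasSum_iff.1 h

theorem primPairs_eq : primPairs = {(1, 1)} ∪
    ((fun x : ℤ × ℤ => (x.1 + x.2, x.2)) '' primPairs ∪
      (fun x : ℤ × ℤ => (x.1, x.1 + x.2)) '' primPairs) := by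
  ext ⟨m, n⟩
  simp only [primPairs, Set.mem_ofPred_eq, Set.mem_union, Set.mem_singleton_iff, Prod.mk.injEq,
    Set.mem_image, Prod.exists]
  constructor
  · rintro ⟨h, hm, hn⟩
    rcases lt_trichotomy m n with hlt | rfl | hlt
    · refine Or.inr (Or.inr ⟨m, n - m, ⟨?_, hm, by omega⟩, rfl, by ring⟩)
      simpa [sub_eq_add_neg] using (IsCoprime.add_mul_left_right h (-1))
    · left
      rw [isCoprime_self, Int.isUnit_iff] at h
      omega
    · refine Or.inr (Or.inl ⟨m - n, n, ⟨?_, by omega, hn⟩, by ring, rfl⟩)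
      simpa [sub_eq_add_neg] using (IsCoprime.add_mul_left_left h (-1))
  · rintro (⟨rfl, rfl⟩ | ⟨x, y, ⟨h, hx, hy⟩, rfl, rfl⟩ | ⟨x, y, ⟨h, hx, hy⟩, rfl, rfl⟩)
    · exact ⟨isCoprime_one_left, by omega, by omega⟩
    · exact ⟨by simpa using h.add_mul_left_left 1, by omega, by omega⟩
    · exact ⟨by simpa [add_comm] using h.add_mul_left_right 1, by omega, by omega⟩

theorem hasSum_primPairs {f : ℤ × ℤ → ℝ} {r s : ℝ}
    (hr : HasSum (fun x : primPairs => f (x.1.1 + x.1.2, x.1.2)) r)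
    (hs : HasSum (fun x : primPairs => f (x.1.1, x.1.1 + x.1.2)) s) :
    HasSum (fun x : primPairs => f x) (f (1, 1) + (r + s)) := by
  have hl : Function.Injective (fun x : ℤ × ℤ => (x.1 + x.2, x.2)) := by
    rintro ⟨x, y⟩ ⟨x', y'⟩ h
    simp only [Prod.mk.injEq] at h ⊢
    omega
  have hr' : Function.Injective (fun x : ℤ × ℤ => (x.1, x.1 + x.2)) := by
    rintro ⟨x, y⟩ ⟨x', y'⟩ h
    simp only [Prod.mk.injEq] at h ⊢
    omega
  have h1 := hasSum_image_of_injective (f := f) hl (s := primPairs) hr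
  have h2 := hasSum_image_of_injective (f := f) hr' (s := primPairs) hs
  have h3 : HasSum (f ∘ Subtype.val : (({(1, 1)} : Set (ℤ × ℤ)) → ℝ)) (f (1, 1)) :=
    hasSum_singleton (1, 1) f
  rw [primPairs_eq]
  refine HasSum.add_disjoint ?_ h3 (HasSum.add_disjoint ?_ h1 h2)
  · rw [Set.disjoint_left]
    rintro _ rfl
    simp only [primPairs, Set.mem_ofPred_eq, Set.mem_union, Prod.mk.injEq, Set.mem_image,
      Prod.exists]
    rintro (⟨x, y, ⟨-, hx, hy⟩, h, h'⟩ | ⟨x, y, ⟨-, hx, hy⟩, h, h'⟩) <;> omega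
  · rw [Set.disjoint_left]
    rintro _ ⟨⟨x, y⟩, ⟨-, hx, hy⟩, rfl⟩ ⟨⟨x', y'⟩, ⟨-, hx', hy'⟩, h⟩
    simp only [Prod.mk.injEq] at h hx hy hx' hy'
    omega

theorem term_left (x : ℤ × ℤ) :
    term T u v p q (x.1 + x.2, x.2) = term T u (u + v) p (p + q) x := by
  have h : (x.1 + x.2) • u + x.2 • v = x.1 • u + x.2 • (u + v) := by module
  simp only [term, height, h]
  push_cast
  ring

theorem term_right (x : ℤ × ℤ) :
    term T u v p q (x.1, x.1 + x.2) = term T (u + v) v (p + q) q x := by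
  have h : x.1 • u + (x.1 + x.2) • v = x.1 • (u + v) + x.2 • v := by module
  simp only [term, height, h]
  push_cast
  ring

theorem hasSum_term {r s : ℝ}
    (hr : HasSum (fun x : primPairs => term T u (u + v) p (p + q) x) r)
    (hs : HasSum (fun x : primPairs => term T (u + v) v (p + q) q x) s) :
    HasSum (fun x : primPairs => term T u v p q x)
      ((p + q) * Real.log (T (u + v) ^ 2 / (T (u + v) ^ 2 - 4)) + (r + s)) := by
  have h := hasSum_primPairs (f := term T u v p q) (by simpa only [term_left] using hr)
    (by simpa only [term_right] using hs)
  simpa [term, height] using h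

/-- An edge directed away from the minimum of the traces, with traces growing exponentially in the
height. -/
structure IsOutward (T : ℤ × ℤ → ℝ) (κ : ℝ) (u v : ℤ × ℤ) (p q : ℝ) : Prop extends
    IsEdge T u v where
  le_left : 1 ≤ p
  le_right : 1 ≤ q
  outward : T u * T v ≤ 2 * T (u + v)
  growth_left : 2 * Real.exp (κ * p) ≤ T u
  growth_right : 2 * Real.exp (κ * q) ≤ T v

variable {κ : ℝ}

theorem IsOutward.growth (h : IsOutward T κ u v p q) :
    2 * Real.exp (κ * (p + q)) ≤ T (u + v) := by
  have h1 := Real.exp_pos (κ * p)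
  have h2 := Real.exp_pos (κ * q)
  have := mul_le_mul h.growth_left h.growth_right (by positivity)
    (by linarith [h.markoff.two_lt_left])
  rw [mul_add, Real.exp_add]
  linarith [h.outward]

theorem IsOutward.left (hT : IsTraceFunction a b c T) (h : IsOutward T κ u v p q) :
    IsOutward T κ u (u + v) p (p + q) where
  toIsEdge := h.toIsEdge.left hT
  le_left := h.le_left
  le_right := by linarith [h.le_left, h.le_right]
  growth_left := h.growth_left
  growth_right := h.growth
  outward := by
    rw [hT.map_left h.det]
    have := h.outward
    obtain ⟨hx, hy, hz, -⟩ := h.markoff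
    nlinarith

theorem IsOutward.right (hT : IsTraceFunction a b c T) (h : IsOutward T κ u v p q) :
    IsOutward T κ (u + v) v (p + q) q where
  toIsEdge := h.toIsEdge.right hT
  le_left := by linarith [h.le_left, h.le_right]
  le_right := h.le_right
  growth_left := h.growth
  growth_right := h.growth_right
  outward := by
    rw [hT.map_right h.det]
    have := h.outward
    obtain ⟨hx, hy, hz, -⟩ := h.markoff
    nlinarith

theorem IsOutward.growth_comb (hT : IsTraceFunction a b c T) (N : ℕ) {x : ℤ × ℤ}
    (hx : x ∈ primPairs) (hN : x.1 + x.2 ≤ N) (h : IsOutward T κ u v p q) :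
    2 * Real.exp (κ * height p q x) ≤ T (x.1 • u + x.2 • v) := by
  induction N generalizing x u v p q with
  | zero =>
    obtain ⟨-, h1, h2⟩ := hx
    push_cast at hN
    omega
  | succ N ih =>
    rw [primPairs_eq] at hx
    push_cast at hN
    rcases hx with rfl | ⟨y, hy, rfl⟩ | ⟨y, hy, rfl⟩
    · simpa [height] using h.growth
    · have := ih hy (by have := hy.2.2; simp only at hN; omega) (h.left hT)
      convert this using 2
      · simp only [height]; push_cast; ring_nf
      · module
    · have := ih hy (by have := hy.2.1; simp only at hN; omega) (h.right hT)
      convert this using 2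
      · simp only [height]; push_cast; ring_nf
      · module

theorem IsEdge.two_lt_comb (hT : IsTraceFunction a b c T) (N : ℕ) {x : ℤ × ℤ}
    (hx : x ∈ primPairs) (hN : x.1 + x.2 ≤ N) (h : IsEdge T u v) :
    2 < T (x.1 • u + x.2 • v) := by
  induction N generalizing x u v with
  | zero =>
    obtain ⟨-, h1, h2⟩ := hx
    push_cast at hN
    omega
  | succ N ih =>
    rw [primPairs_eq] at hx
    push_cast at hN
    rcases hx with rfl | ⟨y, hy, rfl⟩ | ⟨y, hy, rfl⟩
    · simpa using h.markoff.two_lt_right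
    · have := ih hy (by have := hy.2.2; simp only at hN; omega) (h.left hT)
      convert this using 2
      module
    · have := ih hy (by have := hy.2.1; simp only at hN; omega) (h.right hT)
      convert this using 2
      module

theorem four_div_le {κ h t : ℝ} (hκ : 0 < κ) (hh : 0 < h) (ht : 2 * Real.exp (κ * h) ≤ t) :
    4 / (t ^ 2 - 4) ∈ Set.Icc 0 (120 / (2 * κ) ^ 5 / h ^ 5) := by
  have h1 : 1 + (2 * (κ * h)) ^ 5 / 120 ≤ Real.exp (κ * h) ^ 2 := by
    rw [← Real.exp_nat_mul]
    have hp : 0 < κ * h := by positivity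
    have := Real.sum_le_exp_of_nonneg (x := 2 * (κ * h)) (by positivity) 6
    simp only [Finset.sum_range_succ, Finset.sum_range_zero, Nat.factorial] at this
    push_cast at this ⊢
    refine le_trans ?_ this
    have h2 : 0 < 2 * (κ * h) := by positivity
    generalize 2 * (κ * h) = s at *
    norm_num
    have e2 : 0 ≤ s ^ 2 := by positivity
    have e3 : 0 ≤ s ^ 3 := by positivity
    have e4 : 0 ≤ s ^ 4 := by positivity
    linarith
  have h2 : 4 * ((2 * (κ * h)) ^ 5 / 120) ≤ t ^ 2 - 4 := by
    have := Real.exp_pos (κ * h)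
    nlinarith
  have h3 : 0 < 4 * ((2 * (κ * h)) ^ 5 / 120) := by positivity
  refine ⟨div_nonneg (by norm_num) (h3.le.trans h2), ?_⟩
  refine (div_le_div_of_nonneg_left (by norm_num) h3 h2).trans_eq ?_
  field_simp

theorem log_sq_div_mem_Icc {t : ℝ} (ht : 2 < t) :
    Real.log (t ^ 2 / (t ^ 2 - 4)) ∈ Set.Icc 0 (4 / (t ^ 2 - 4)) := by
  have h : 0 < t ^ 2 - 4 := by nlinarith
  have e : t ^ 2 / (t ^ 2 - 4) = 1 + 4 / (t ^ 2 - 4) := by field_simp; ring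
  have h4 : 0 < 4 / (t ^ 2 - 4) := by positivity
  rw [e]
  refine ⟨Real.log_nonneg (by linarith), ?_⟩
  linarith [Real.log_le_sub_one_of_pos (by linarith : 0 < 1 + 4 / (t ^ 2 - 4))]

theorem summable_primPairs :
    Summable (fun x : primPairs => 1 / (x.1.1 : ℝ) ^ 2 * (1 / (x.1.2 : ℝ) ^ 2)) := by
  have h : Summable (fun n : ℤ => 1 / (n : ℝ) ^ 2) :=
    Real.summable_one_div_int_pow.2 (by norm_num)
  exact (h.mul_of_nonneg h (fun _ => by positivity) (fun _ => by positivity)).subtype primPairs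

theorem IsOutward.term_mem_Icc (hT : IsTraceFunction a b c T) (hκ : 0 < κ)
    (h : IsOutward T κ u v p q) {x : ℤ × ℤ} (hx : x ∈ primPairs) :
    term T u v p q x ∈ Set.Icc 0 (120 / (2 * κ) ^ 5 / (p * q) ^ 2 *
      (1 / (x.1 : ℝ) ^ 2 * (1 / (x.2 : ℝ) ^ 2))) := by
  have hg := h.growth_comb hT (x.1 + x.2).toNat hx (Int.self_le_toNat _)
  have hp := h.le_left
  have hq := h.le_right
  have hm : (1 : ℝ) ≤ x.1 := by exact_mod_cast hx.2.1
  have hn : (1 : ℝ) ≤ x.2 := by exact_mod_cast hx.2.2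
  have hh : 0 < height p q x := by unfold height; positivity
  have h1 := four_div_le hκ hh hg
  have ht : 2 < T (x.1 • u + x.2 • v) := by
    have : 1 < Real.exp (κ * height p q x) := Real.one_lt_exp_iff.2 (by positivity)
    linarith
  have h2 := log_sq_div_mem_Icc ht
  refine ⟨mul_nonneg hh.le h2.1, ?_⟩
  unfold term
  refine (mul_le_mul_of_nonneg_left (h2.2.trans h1.2) hh.le).trans ?_
  have hK : 0 < 120 / (2 * κ) ^ 5 := by positivity
  generalize 120 / (2 * κ) ^ 5 = K at *
  have h3 : x.1 * p * (x.2 * q) ≤ height p q x ^ 2 := by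
    unfold height
    have hmp : 0 < x.1 * p := by positivity
    have hnq : 0 < x.2 * q := by positivity
    nlinarith [sq_nonneg (x.1 * p - x.2 * q), mul_pos hmp hnq]
  have h4 : (x.1 * p * (x.2 * q)) ^ 2 ≤ height p q x ^ 4 := by
    calc _ ≤ (height p q x ^ 2) ^ 2 := by gcongr
      _ = _ := by ring
  have e1 : height p q x * (K / height p q x ^ 5) = K / height p q x ^ 4 := by
    field_simp
  have e2 : K / (p * q) ^ 2 * (1 / (x.1 : ℝ) ^ 2 * (1 / (x.2 : ℝ) ^ 2)) =
      K / (x.1 * p * (x.2 * q)) ^ 2 := by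
    field_simp
  rw [e1, e2]
  gcongr

theorem IsOutward.summable (hT : IsTraceFunction a b c T) (hκ : 0 < κ)
    (h : IsOutward T κ u v p q) : Summable (fun x : primPairs => term T u v p q x) :=
  Summable.of_nonneg_of_le (fun x => (h.term_mem_Icc hT hκ x.2).1)
    (fun x => (h.term_mem_Icc hT hκ x.2).2) (summable_primPairs.mul_left _)

theorem IsOutward.edgeGap_mem_Icc (hκ : 0 < κ) (h : IsOutward T κ u v p q) :
    edgeGap T u v p q ∈ Set.Icc 0 (2 * (120 / (2 * κ) ^ 5) ^ 2 / (p * q) ^ 2) := by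
  have hp := h.le_left
  have hq := h.le_right
  have h1 := h.markoff.gap_mem_Icc h.outward
  have h2 := h.markoff.swap.gap_mem_Icc (by linarith [h.outward])
  have h3 := four_div_le hκ (by linarith) h.growth_left
  have h4 := four_div_le hκ (by linarith) h.growth_right
  unfold edgeGap
  have h5 := mul_le_mul h3.2 h4.2 h4.1 (h3.1.trans h3.2)
  have hK : 0 < 120 / (2 * κ) ^ 5 := by positivity
  generalize 120 / (2 * κ) ^ 5 = K at *
  have h6 := h1.2.trans h5
  have h7 := h2.2.trans ((mul_comm _ _).trans_le h5)
  refine ⟨add_nonneg (mul_nonneg (by linarith) h1.1) (mul_nonneg (by linarith) h2.1), ?_⟩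
  have h8 : ∀ r, 1 ≤ r → r ≤ p * q → r * (K / p ^ 5 * (K / q ^ 5)) ≤ K ^ 2 / (p * q) ^ 2 := by
    intro r hr hrpq
    have e : r * (K / p ^ 5 * (K / q ^ 5)) = K ^ 2 * r / (p * q) ^ 5 := by
      field_simp
    have h1 : 1 ≤ p * q := hr.trans hrpq
    rw [e, div_le_div_iff₀ (by positivity) (by positivity)]
    have : r * (p * q) ^ 2 ≤ (p * q) ^ 5 := by
      calc r * (p * q) ^ 2 ≤ (p * q) * (p * q) ^ 2 := by gcongr
        _ = (p * q) ^ 3 := by ring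
        _ ≤ (p * q) ^ 5 := pow_le_pow_right₀ h1 (by norm_num)
    calc K ^ 2 * r * (p * q) ^ 2 = K ^ 2 * (r * (p * q) ^ 2) := by ring
      _ ≤ _ := by gcongr
  have h9 := h8 p hp (by nlinarith)
  have h10 := h8 q hq (by nlinarith)
  have h11 := mul_le_mul_of_nonneg_left h6 (by linarith : 0 ≤ p)
  have h12 := mul_le_mul_of_nonneg_left h7 (by linarith : 0 ≤ q)
  calc _ ≤ K ^ 2 / (p * q) ^ 2 + K ^ 2 / (p * q) ^ 2 := by linarith
    _ = _ := by ring

theorem IsOutward.exists_abs_sub_le (hT : IsTraceFunction a b c T) (hκ : 0 < κ) :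
    ∃ B : ℝ, 0 ≤ B ∧ ∀ (N : ℕ) (u v : ℤ × ℤ) (p q : ℝ), IsOutward T κ u v p q →
      |(∑' x : primPairs, term T u v p q x) - edgeGap T u v p q| ≤
        B / (p * q * (p + q + N)) := by
  have hK : 0 < 120 / (2 * κ) ^ 5 := by positivity
  set K := 120 / (2 * κ) ^ 5
  set σ := ∑' x : primPairs, 1 / (x.1.1 : ℝ) ^ 2 * (1 / (x.1.2 : ℝ) ^ 2) with hσ
  have hσ0 : 0 ≤ σ := tsum_nonneg fun x => by positivity
  refine ⟨2 * (K * σ + 2 * K ^ 2), by positivity, fun N => ?_⟩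
  induction N with
  | zero =>
    intro u v p q h
    have hp := h.le_left
    have hq := h.le_right
    have h1 : 0 ≤ ∑' x : primPairs, term T u v p q x :=
      tsum_nonneg fun x => (h.term_mem_Icc hT hκ x.2).1
    have h2 : ∑' x : primPairs, term T u v p q x ≤ K / (p * q) ^ 2 * σ := by
      rw [hσ, ← tsum_mul_left]
      exact (h.summable hT hκ).tsum_le_tsum (fun x => (h.term_mem_Icc hT hκ x.2).2)
        (summable_primPairs.mul_left _)
    have h3 := h.edgeGap_mem_Icc hκ
    have h4 : |(∑' x : primPairs, term T u v p q x) - edgeGap T u v p q| ≤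
        (K * σ + 2 * K ^ 2) / (p * q) ^ 2 := by
      have e : (K * σ + 2 * K ^ 2) / (p * q) ^ 2 =
        K / (p * q) ^ 2 * σ + 2 * K ^ 2 / (p * q) ^ 2 := by ring
      rw [e, abs_le]
      constructor <;> linarith [h3.1, h3.2]
    refine h4.trans ?_
    push_cast
    rw [add_zero, div_le_div_iff₀ (by positivity) (by positivity)]
    have h5 : p + q ≤ 2 * (p * q) := by nlinarith
    calc (K * σ + 2 * K ^ 2) * (p * q * (p + q))
        ≤ (K * σ + 2 * K ^ 2) * (p * q * (2 * (p * q))) := by gcongr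
      _ = _ := by ring
  | succ N ih =>
    intro u v p q h
    have hp := h.le_left
    have hq := h.le_right
    have hl := h.left hT
    have hr := h.right hT
    have h1 := ih _ _ _ _ hl
    have h2 := ih _ _ _ _ hr
    have h3 := (hasSum_term (hl.summable hT hκ).hasSum (hr.summable hT hκ).hasSum).tsum_eq
    rw [h3, edgeGap_eq hT h.toIsEdge, add_sub_add_left_eq_sub, add_sub_add_comm]
    refine (abs_add_le _ _).trans ((add_le_add h1 h2).trans ?_)
    generalize 2 * (K * σ + 2 * K ^ 2) = B at *
    push_cast
    have hB : 0 ≤ B := by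
      have := (abs_nonneg _).trans h1
      by_contra! hneg
      exact absurd this (not_le.2 (div_neg_of_neg_of_pos hneg (by positivity)))
    have e : B / (p * q * (p + q + (N + 1))) = B / (p * (p + q) * (p + q + (N + 1))) +
        B / ((p + q) * q * (p + q + (N + 1))) := by
      field_simp
      ring
    rw [e]
    gcongr ?_ + ?_
    · gcongr B / (_ * ?_)
      linarith
    · gcongr B / (_ * ?_)
      linarith

theorem IsOutward.hasSum (hT : IsTraceFunction a b c T) (hκ : 0 < κ)
    (h : IsOutward T κ u v p q) :
    HasSum (fun x : primPairs => term T u v p q x) (edgeGap T u v p q) := by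
  obtain ⟨B, hB, hbound⟩ := IsOutward.exists_abs_sub_le hT hκ
  have hp := h.le_left
  have hq := h.le_right
  have hlim : Filter.Tendsto (fun N : ℕ => B / (p * q * (p + q + N))) Filter.atTop (nhds 0) := by
    refine Filter.Tendsto.div_atTop tendsto_const_nhds ?_
    refine Filter.Tendsto.const_mul_atTop (by positivity) ?_
    exact Filter.tendsto_atTop_add_const_left _ _ tendsto_natCast_atTop_atTop
  have h0 := ge_of_tendsto' hlim (fun N => hbound N u v p q h)
  have h1 := sub_eq_zero.1 (abs_nonpos_iff.1 h0)
  rw [← h1]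
  exact (h.summable hT hκ).hasSum

theorem IsEdge.hasSum_of_outward (hT : IsTraceFunction a b c T) (h : IsEdge T u v)
    (hp : 1 ≤ p) (hq : 1 ≤ q) (ho : T u * T v ≤ 2 * T (u + v)) :
    HasSum (fun x : primPairs => term T u v p q x) (edgeGap T u v p q) := by
  have key : ∀ t r : ℝ, 2 < t → 1 ≤ r → ∃ κ > 0, ∀ κ' ≤ κ, 2 * Real.exp (κ' * r) ≤ t := by
    intro t r ht hr
    refine ⟨Real.log (t / 2) / r, div_pos (Real.log_pos (by linarith)) (by linarith), ?_⟩
    intro κ' hκ'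
    rw [le_div_iff₀ (by linarith), Real.le_log_iff_exp_le (by linarith)] at hκ'
    linarith
  obtain ⟨κ₁, h1, h1'⟩ := key _ p h.markoff.two_lt_left hp
  obtain ⟨κ₂, h2, h2'⟩ := key _ q h.markoff.two_lt_mid hq
  exact IsOutward.hasSum hT (lt_min h1 h2)
    ⟨h, hp, hq, ho, h1' _ (min_le_left _ _), h2' _ (min_le_right _ _)⟩

/-- Descent step: a Markoff triple reached by an inward flip either leaves only outward edges, or
the flip decreased the trace by a definite amount. -/
theorem MarkoffTriple.flip_gap {x y z M : ℝ} (h : MarkoffTriple x y z) (hy : y ≤ M)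
    (hM : x * y - z ≤ M) (hin : x * z < 2 * y) : z + 8 / M ^ 2 ≤ x * y - z := by
  obtain ⟨hx, hy2, hz, h⟩ := h
  set w := x * y - z with hw
  have hz' : z = x * y - w := by rw [hw]; ring
  have hzw : z * w = x ^ 2 + y ^ 2 := by rw [hw]; linear_combination -h
  have hw0 : 0 < w := by
    by_contra! h0
    nlinarith
  have h1 : x * w * y = x ^ 2 + y ^ 2 + w ^ 2 := by rw [hw]; linear_combination -h
  have hM0 : 0 < M := by linarith
  have hyw : y * w ≤ M ^ 2 := by nlinarith
  have h2 : x ^ 2 ≤ (x - 2) * (y * w) := by nlinarith [sq_nonneg (y - w)]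
  have h3 : 4 ≤ (x - 2) * M ^ 2 := by
    have : (x - 2) * (y * w) ≤ (x - 2) * M ^ 2 := by gcongr
    nlinarith
  have h4 : 2 * (x - 2) ≤ w - z := by
    have h5 : y * (x ^ 2 - 4) < x * (w - z) := by
      have : w - z = x * y - 2 * z := by rw [hw]; ring
      rw [this]
      nlinarith
    have h6 : x * (2 * (x - 2)) ≤ y * (x ^ 2 - 4) := by
      have : 0 ≤ (x - 2) * (y * (x + 2) - 2 * x) :=
        mul_nonneg (by linarith) (by nlinarith)
      linarith
    exact (lt_of_mul_lt_mul_left (h6.trans_lt h5) (by linarith)).le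
  have h5 : 8 / M ^ 2 ≤ 2 * (x - 2) := by
    rw [div_le_iff₀ (by positivity)]
    linarith
  linarith

theorem IsEdge.hasSum_of_le (hT : IsTraceFunction a b c T) {M : ℝ} (N : ℕ) (h : IsEdge T u v)
    (hp : 1 ≤ p) (hq : 1 ≤ q) (hu : T u ≤ M) (hv : T v ≤ M) (hw : T u * T v - T (u + v) ≤ M)
    (hN : T u + T v + (T u * T v - T (u + v)) ≤ N * (8 / M ^ 2)) :
    HasSum (fun x : primPairs => term T u v p q x) (edgeGap T u v p q) := by
  induction N generalizing u v p q with
  | zero =>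
    have h1 := h.markoff.two_lt_left
    have h2 := h.markoff.two_lt_mid
    have h3 := h.markoff.swap.rotate.flip.two_lt_right
    push_cast at hN
    linarith
  | succ N ih =>
    by_cases ho : T u * T v ≤ 2 * T (u + v)
    · exact h.hasSum_of_outward hT hp hq ho
    push Not at ho
    push_cast at hN
    rw [edgeGap_eq hT h]
    have hl := h.left hT
    have hr := h.right hT
    refine hasSum_term ?_ ?_
    · by_cases ho' : T u * T (u + v) ≤ 2 * T (u + (u + v))
      · exact hl.hasSum_of_outward hT hp (by linarith) ho'
      · rw [hT.map_left h.det] at ho'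
        have := h.markoff.flip_gap hv hw (by linarith)
        refine ih hl hp (by linarith) hu (by linarith) ?_ ?_ <;>
        · rw [hT.map_left h.det]
          linarith
    · by_cases ho' : T (u + v) * T v ≤ 2 * T (u + v + v)
      · exact hr.hasSum_of_outward hT (by linarith) hq ho'
      · rw [hT.map_right h.det] at ho'
        have := h.markoff.swap.flip_gap hu (by linarith) (by linarith)
        refine ih hr (by linarith) hq (by linarith) hv ?_ ?_ <;>
        · rw [hT.map_right h.det]
          linarith

theorem IsEdge.hasSum (hT : IsTraceFunction a b c T) (h : IsEdge T u v)
    (hp : 1 ≤ p) (hq : 1 ≤ q) :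
    HasSum (fun x : primPairs => term T u v p q x) (edgeGap T u v p q) := by
  have hu := h.markoff.two_lt_left
  set M := max (max (T u) (T v)) (T u * T v - T (u + v))
  have h1 : T u ≤ M := (le_max_left _ _).trans (le_max_left _ _)
  have h2 : T v ≤ M := (le_max_right _ _).trans (le_max_left _ _)
  have h3 : 0 < 8 / M ^ 2 := by
    have : 0 < M := by linarith
    positivity
  obtain ⟨N, hN⟩ := exists_nat_ge
    ((T u + T v + (T u * T v - T (u + v))) / (8 / M ^ 2))
  rw [div_le_iff₀ h3] at hN
  exact h.hasSum_of_le hT N hp hq h1 h2 (le_max_right _ _) hN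

end Edge

theorem primitive_up_to_sign_eq :
    {v : ℤ × ℤ | IsCoprime v.1 v.2 ∧ (0 < v.2 ∨ v = (1, 0))} =
      (({(1, 0)} ∪ {(0, 1)}) ∪ {(1, 1)}) ∪
      (((fun x : ℤ × ℤ => x.1 • ((1, 0) : ℤ × ℤ) + x.2 • ((1, 1) : ℤ × ℤ)) '' primPairs ∪
        (fun x : ℤ × ℤ => x.1 • ((1, 1) : ℤ × ℤ) + x.2 • ((0, 1) : ℤ × ℤ)) '' primPairs) ∪
        (fun x : ℤ × ℤ => x.1 • ((0, 1) : ℤ × ℤ) + x.2 • ((-1, 0) : ℤ × ℤ)) '' primPairs) := by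
  ext ⟨p, q⟩
  simp only [primPairs, Set.mem_ofPred_eq, Set.mem_union, Set.mem_singleton_iff, Prod.mk.injEq,
    Set.mem_image, Prod.exists, Prod.smul_mk, Prod.mk_add_mk, smul_eq_mul, mul_one, mul_zero,
    zero_add, add_zero, mul_neg]
  constructor
  · rintro ⟨h, hq | hq⟩
    · rcases lt_trichotomy p 0 with hp | rfl | hp
      · exact Or.inr (Or.inr ⟨q, -p, ⟨h.symm.neg_right, hq, by omega⟩, by ring, rfl⟩)
      · rw [isCoprime_zero_left, Int.isUnit_iff] at h
        omega
      · rcases lt_trichotomy p q with hlt | rfl | hlt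
        · refine Or.inr (Or.inl (Or.inr ⟨p, q - p, ⟨?_, hp, by omega⟩, rfl, by ring⟩))
          simpa [sub_eq_add_neg] using (IsCoprime.add_mul_left_right h (-1))
        · rw [isCoprime_self, Int.isUnit_iff] at h
          omega
        · refine Or.inr (Or.inl (Or.inl ⟨p - q, q, ⟨?_, by omega, hq⟩, by ring, rfl⟩))
          simpa [sub_eq_add_neg] using (IsCoprime.add_mul_left_left h (-1))
    · exact Or.inl (Or.inl (Or.inl hq))
  · rintro (((⟨rfl, rfl⟩ | ⟨rfl, rfl⟩) | ⟨rfl, rfl⟩) | ((⟨x, y, ⟨h, hx, hy⟩, rfl, rfl⟩ |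
      ⟨x, y, ⟨h, hx, hy⟩, rfl, rfl⟩) | ⟨x, y, ⟨h, hx, hy⟩, rfl, rfl⟩))
    · exact ⟨isCoprime_one_left, by omega⟩
    · exact ⟨isCoprime_one_right, by omega⟩
    · exact ⟨isCoprime_one_left, by omega⟩
    · exact ⟨by simpa using h.add_mul_left_left 1, by omega⟩
    · exact ⟨by simpa [add_comm] using h.add_mul_left_right 1, by omega⟩
    · exact ⟨h.symm.neg_left, by omega⟩

theorem hasSum_primitive_up_to_sign {f : ℤ × ℤ → ℝ} {r s t : ℝ}
    (hr : HasSum (fun x : primPairs =>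
      f (x.1.1 • ((1, 0) : ℤ × ℤ) + x.1.2 • ((1, 1) : ℤ × ℤ))) r)
    (hs : HasSum (fun x : primPairs =>
      f (x.1.1 • ((1, 1) : ℤ × ℤ) + x.1.2 • ((0, 1) : ℤ × ℤ))) s)
    (ht : HasSum (fun x : primPairs =>
      f (x.1.1 • ((0, 1) : ℤ × ℤ) + x.1.2 • ((-1, 0) : ℤ × ℤ))) t) :
    HasSum (fun v : {v : ℤ × ℤ | IsCoprime v.1 v.2 ∧ (0 < v.2 ∨ v = (1, 0))} => f v)
      (f (1, 0) + f (0, 1) + f (1, 1) + (r + s + t)) := by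
  have hsing (w : ℤ × ℤ) : HasSum (f ∘ Subtype.val : (({w} : Set (ℤ × ℤ)) → ℝ)) (f w) :=
    hasSum_singleton w f
  have inj {u v : ℤ × ℤ} (h : u.1 * v.2 - u.2 * v.1 = 1) :
      Function.Injective (fun x : ℤ × ℤ => x.1 • u + x.2 • v) := by
    rintro ⟨m, n⟩ ⟨m', n'⟩ e
    simp only [Prod.ext_iff, Prod.fst_add, Prod.snd_add, Prod.smul_fst, Prod.smul_snd,
      smul_eq_mul] at e ⊢
    constructor
    · linear_combination v.2 * e.1 - v.1 * e.2 - (m - m') * h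
    · linear_combination u.1 * e.2 - u.2 * e.1 - (n - n') * h
  have h1 := hasSum_image_of_injective (f := f) (inj (by norm_num)) (s := primPairs) hr
  have h2 := hasSum_image_of_injective (f := f) (inj (by norm_num)) (s := primPairs) hs
  have h3 := hasSum_image_of_injective (f := f) (inj (by norm_num)) (s := primPairs) ht
  rw [primitive_up_to_sign_eq]
  refine HasSum.add_disjoint ?_
    (HasSum.add_disjoint ?_ (HasSum.add_disjoint ?_ (hsing _) (hsing _)) (hsing _))
    (HasSum.add_disjoint ?_ (HasSum.add_disjoint ?_ h1 h2) h3)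
  all_goals
    rw [Set.disjoint_left]
    rintro ⟨p, q⟩
    simp only [primPairs, Set.mem_ofPred_eq, Set.mem_union, Set.mem_singleton_iff,
      Prod.mk.injEq, Set.mem_image, Prod.exists, Prod.smul_mk, Prod.mk_add_mk, smul_eq_mul,
      mul_one, mul_zero, zero_add, add_zero, mul_neg]
    grind

/-- The hexagonal height `max |p| |q| |p - q|` of an integral vector. -/
def hexHeight (v : ℤ × ℤ) : ℤ := max (max |v.1| |v.2|) |v.1 - v.2|

theorem hexHeight_comb {x : ℤ × ℤ} (hx : x ∈ primPairs) :
    hexHeight (x.1 • ((1, 0) : ℤ × ℤ) + x.2 • ((1, 1) : ℤ × ℤ)) = x.1 + x.2 ∧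
      hexHeight (x.1 • ((1, 1) : ℤ × ℤ) + x.2 • ((0, 1) : ℤ × ℤ)) = x.1 + x.2 ∧
      hexHeight (x.1 • ((0, 1) : ℤ × ℤ) + x.2 • ((-1, 0) : ℤ × ℤ)) = x.1 + x.2 := by
  obtain ⟨m, n⟩ := x
  obtain ⟨-, hm, hn⟩ := hx
  simp only at hm hn
  simp only [hexHeight, Prod.smul_mk, Prod.mk_add_mk, smul_eq_mul, mul_one, mul_zero, zero_add,
    add_zero, mul_neg]
  refine ⟨?_, ?_, ?_⟩ <;> grind

/-- The main product identity: for a Markoff triple of reals `(a,b,c)` with trace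
function `T`, the product over all primitive vectors up to sign (coprime pairs `(p,q)`
with `q > 0`, together with `(1,0)`) of `(T(p,q)²/(T(p,q)²−4))^h(p,q)`, with height
`h(p,q) = max(|p|,|q|,|p−q|)`, converges to
`((a+√(a²−4))/2)·((b+√(b²−4))/2)·((c+√(c²−4))/2)`. -/
theorem infinite_product_identity (a b c : ℝ) (ha : 2 < a) (hb : 2 < b) (hc : 2 < c)
    (habc : a ^ 2 + b ^ 2 + c ^ 2 = a * b * c)
    (T : ℤ × ℤ → ℝ) (hT : IsTraceFunction a b c T) :
    HasProd
      (fun v : {v : ℤ × ℤ // IsCoprime v.1 v.2 ∧ (0 < v.2 ∨ v = (1, 0))} =>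
        (T v.val ^ 2 / (T v.val ^ 2 - 4)) ^ (max (max |v.val.1| |v.val.2|) |v.val.1 - v.val.2|))
      (((a + Real.sqrt (a ^ 2 - 4)) / 2) * ((b + Real.sqrt (b ^ 2 - 4)) / 2) *
        ((c + Real.sqrt (c ^ 2 - 4)) / 2)) := by
  have hM : MarkoffTriple a b c := ⟨ha, hb, hc, habc⟩
  have prim : Primitive (1, 0) ∧ Primitive (0, 1) := primitive_of_det (by norm_num)
  have s1 : T ((1, 0) - (1, 1)) = a := by
    rw [← hT.map_01, ← hT.neg_eq _ prim.2]
    rfl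
  have s2 : T ((1, 1) - (0, 1)) = c := hT.map_10
  have s3 : T ((0, 1) - (-1, 0)) = b := hT.map_11
  have tn : T (-1, 0) = c := by
    rw [← hT.map_10, ← hT.neg_eq _ prim.1]
    rfl
  have d1 : ((1, 0) : ℤ × ℤ).1 * ((1, 1) : ℤ × ℤ).2 -
    ((1, 0) : ℤ × ℤ).2 * ((1, 1) : ℤ × ℤ).1 = 1 := by norm_num
  have d2 : ((1, 1) : ℤ × ℤ).1 * ((0, 1) : ℤ × ℤ).2 -
    ((1, 1) : ℤ × ℤ).2 * ((0, 1) : ℤ × ℤ).1 = 1 := by norm_num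
  have d3 : ((0, 1) : ℤ × ℤ).1 * ((-1, 0) : ℤ × ℤ).2 -
    ((0, 1) : ℤ × ℤ).2 * ((-1, 0) : ℤ × ℤ).1 = 1 := by norm_num
  have e1 : IsEdge T (1, 0) (1, 1) := hT.isEdge d1 (by
    rw [s1, hT.map_10, hT.map_11]; exact hM.rotate.rotate)
  have e2 : IsEdge T (1, 1) (0, 1) := hT.isEdge d2 (by
    rw [s2, hT.map_11, hT.map_01]; exact hM.rotate)
  have e3 : IsEdge T (0, 1) (-1, 0) := hT.isEdge d3 (by
    rw [s3, hT.map_01, tn]; exact hM)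
  have t1 := hT.add_rule _ _ (primitive_of_det d1).1 (primitive_of_det d1).2 (Or.inl d1)
  have t2 := hT.add_rule _ _ (primitive_of_det d2).1 (primitive_of_det d2).2 (Or.inl d2)
  have t3 := hT.add_rule _ _ (primitive_of_det d3).1 (primitive_of_det d3).2 (Or.inl d3)
  rw [s1, hT.map_10, hT.map_11] at t1
  rw [s2, hT.map_11, hT.map_01] at t2
  rw [s3, hT.map_01, tn] at t3
  set f : ℤ × ℤ → ℝ := fun v => hexHeight v * Real.log (T v ^ 2 / (T v ^ 2 - 4))
  have sector {u v : ℤ × ℤ} (h : IsEdge T u v)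
      (hh : ∀ x ∈ primPairs, hexHeight (x.1 • u + x.2 • v) = x.1 + x.2) :
      HasSum (fun x : primPairs => f (x.1.1 • u + x.1.2 • v)) (edgeGap T u v 1 1) := by
    convert h.hasSum hT le_rfl le_rfl using 2 with x
    simp only [f, term, height, hh x x.2]
    push_cast
    ring
  have hsum := hasSum_primitive_up_to_sign (f := f)
    (sector e1 fun x hx => (hexHeight_comb hx).1)
    (sector e2 fun x hx => (hexHeight_comb hx).2.1)
    (sector e3 fun x hx => (hexHeight_comb hx).2.2)
  have two_lt : ∀ v ∈ {v : ℤ × ℤ | IsCoprime v.1 v.2 ∧ (0 < v.2 ∨ v = (1, 0))}, 2 < T v := by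
    intro v hv
    rw [primitive_up_to_sign_eq] at hv
    rcases hv with ((rfl | rfl) | rfl) | ((⟨x, hx, rfl⟩ | ⟨x, hx, rfl⟩) | ⟨x, hx, rfl⟩)
    · rwa [hT.map_10]
    · rwa [hT.map_01]
    · rwa [hT.map_11]
    · exact e1.two_lt_comb hT _ hx (Int.self_le_toNat _)
    · exact e2.two_lt_comb hT _ hx (Int.self_le_toNat _)
    · exact e3.two_lt_comb hT _ hx (Int.self_le_toNat _)
  have hval : f (1, 0) + f (0, 1) + f (1, 1) + (edgeGap T (1, 0) (1, 1) 1 1 +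
      edgeGap T (1, 1) (0, 1) 1 1 + edgeGap T (0, 1) (-1, 0) 1 1) =
      Real.log (eigen a) + Real.log (eigen b) + Real.log (eigen c) := by
    have h1 := hM.log_add_gap_add_gap
    have h2 := hM.rotate.log_add_gap_add_gap
    have h3 := hM.rotate.rotate.log_add_gap_add_gap
    simp only [f, edgeGap, t1, t2, t3, tn, hT.map_10, hT.map_01, hT.map_11]
    have g1 : hexHeight (1, 0) = 1 := by decide
    have g2 : hexHeight (0, 1) = 1 := by decide
    have g3 : hexHeight (1, 1) = 1 := by decide
    rw [g1, g2, g3, mul_comm c b, mul_comm b a]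
    rw [mul_comm b a, mul_comm c a] at h2
    rw [mul_comm c b] at h3
    push_cast
    linarith
  rw [hval] at hsum
  have hprod : HasProd (fun v : {v : ℤ × ℤ // IsCoprime v.1 v.2 ∧ (0 < v.2 ∨ v = (1, 0))} =>
      Real.exp (f v.val)) _ := hsum.rexp
  have hpos {t : ℝ} (ht : 2 < t) : 0 < eigen t := by linarith [one_lt_eigen ht]
  rw [Real.exp_add, Real.exp_add, Real.exp_log (hpos ha), Real.exp_log (hpos hb),
    Real.exp_log (hpos hc)] at hprod
  have hexp : (fun v : {v : ℤ × ℤ // IsCoprime v.1 v.2 ∧ (0 < v.2 ∨ v = (1, 0))} =>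
      Real.exp (f v.val)) = fun v => (T v.val ^ 2 / (T v.val ^ 2 - 4)) ^ hexHeight v.val := by
    funext v
    have hv : 2 < T v := two_lt v v.2
    have hpos' : 0 < T v ^ 2 / (T v ^ 2 - 4) := div_pos (by nlinarith) (by nlinarith)
    simp only [f]
    rw [← Real.log_zpow, Real.exp_log (zpow_pos hpos' _)]
  rw [hexp] at hprod
  exact hprod
end

section
/- Let (a,b,c) be a Markoff triple of reals and T a trace function for (a,b,c). Then the sum over all primitive vectors up to sign, i.e. over all pairs of coprime integers (p,q) with q > 0 together with (p,q) = (1,0), of (1 − √(1 − 4/T(p,q)²))/2, converges and equals 1/2. -/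
open Set

namespace McShane

/-- The summand of McShane's identity as a function of the trace. -/
noncomputable def gap (x : ℝ) : ℝ := (1 - Real.sqrt (1 - 4 / x ^ 2)) / 2

lemma four_div_sq_lt_one {x : ℝ} (hx : 2 < x) : 4 / x ^ 2 < 1 := by
  rw [div_lt_one (by positivity)]; nlinarith

lemma gap_nonneg (x : ℝ) : 0 ≤ gap x := by
  have : Real.sqrt (1 - 4 / x ^ 2) ≤ 1 := by
    have : 0 ≤ 4 / x ^ 2 := by positivity
    exact Real.sqrt_le_one.2 (by linarith)
  unfold gap; linarith

lemma gap_le_half (x : ℝ) : gap x ≤ 1 / 2 := by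
  have := Real.sqrt_nonneg (1 - 4 / x ^ 2)
  unfold gap; linarith

lemma gap_lt_half {x : ℝ} (hx : 2 < x) : gap x < 1 / 2 := by
  have := Real.sqrt_pos.2 (sub_pos.2 (four_div_sq_lt_one hx))
  unfold gap; linarith

lemma gap_mul_one_sub {x : ℝ} (hx : 2 < x) : gap x * (1 - gap x) = 1 / x ^ 2 := by
  have := Real.sq_sqrt (sub_pos.2 (four_div_sq_lt_one hx)).le
  unfold gap
  linear_combination (-1 / 4) * this

lemma gap_anti {x m : ℝ} (hm : 2 < m) (hx : m ≤ x) : gap x ≤ gap m := by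
  have : 4 / x ^ 2 ≤ 4 / m ^ 2 := by gcongr
  have := Real.sqrt_le_sqrt (show 1 - 4 / m ^ 2 ≤ 1 - 4 / x ^ 2 by linarith)
  unfold gap; linarith

lemma add_le_of_mul_one_sub_eq {r s t : ℝ} (hs : 0 ≤ s) (ht : 0 ≤ t) (hs' : s ≤ 1 / 2)
    (ht' : t ≤ 1 / 2) (h : r * (1 - r) = s * (1 - s) + t * (1 - t)) : s + t ≤ r := by
  have hst := mul_nonneg hs ht
  by_contra! hlt
  rcases le_or_gt (s + t) (1 / 2) with h1 | h1
  · nlinarith [mul_pos (sub_pos.2 hlt) (show 0 < 1 - r - (s + t) by linarith)]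
  · nlinarith [mul_nonneg hs (sub_nonneg.2 hs'), mul_nonneg ht (sub_nonneg.2 ht'),
      sq_nonneg (r - 1 / 2)]

lemma mul_sub_le_of_mul_one_sub_eq {r s t κ : ℝ} (ht : 0 ≤ t) (hst : s + t ≤ r)
    (hr : r ≤ 1 / 2) (hκ : κ ≤ 1 / 2 - s)
    (h : r * (1 - r) = s * (1 - s) + t * (1 - t)) : κ * (r - s) ≤ t := by
  nlinarith [mul_nonneg (show 0 ≤ r - s by linarith) (show 0 ≤ 1 - r - s - κ by linarith)]

/-- The integral linear map with matrix rows `(α, β)` and `(γ, δ)`. -/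
def lin (α β γ δ : ℤ) (v : ℤ × ℤ) : ℤ × ℤ := (α * v.1 + β * v.2, γ * v.1 + δ * v.2)

/-- A function on `ℤ²` obeying the trace relations whose values at `(0,1)`, `(1,1)`, `(1,0)` form
a Markoff triple of reals. -/
structure MarkoffTrace (G : ℤ × ℤ → ℝ) : Prop where
  neg_eq : ∀ v : ℤ × ℤ, Primitive v → G (-v) = G v
  add_rule : ∀ v w : ℤ × ℤ, Primitive v → Primitive w →
    (v.1 * w.2 - v.2 * w.1 = 1 ∨ v.1 * w.2 - v.2 * w.1 = -1) →
    G (v + w) = G v * G w - G (v - w)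
  two_lt_01 : 2 < G (0, 1)
  two_lt_11 : 2 < G (1, 1)
  two_lt_10 : 2 < G (1, 0)
  markoff : G (0, 1) ^ 2 + G (1, 1) ^ 2 + G (1, 0) ^ 2 = G (0, 1) * G (1, 1) * G (1, 0)

lemma primitive_lin {α β γ δ : ℤ} (h : α * δ - β * γ = 1 ∨ α * δ - β * γ = -1) {v : ℤ × ℤ}
    (hv : Primitive v) : Primitive (lin α β γ δ v) := by
  obtain ⟨u, t, hut⟩ := hv
  have he : (α * δ - β * γ) ^ 2 = 1 := by rcases h with h | h <;> rw [h] <;> norm_num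
  refine ⟨(α * δ - β * γ) * (u * δ - t * γ), (α * δ - β * γ) * (t * α - u * β), ?_⟩
  simp only [lin]
  linear_combination (α * δ - β * γ) ^ 2 * hut + he

lemma two_lt_of_markoff {x y z : ℝ} (hx : 0 < x) (hy : 0 < y) (hz : 0 < z)
    (h : x ^ 2 + y ^ 2 + z ^ 2 = x * y * z) : 2 < z := by
  by_contra! h2
  nlinarith [sq_nonneg (x - y), mul_nonneg (mul_pos hx hy).le (sub_nonneg.2 h2), pow_pos hz 2]

namespace MarkoffTrace

variable {G : ℤ × ℤ → ℝ}

lemma comp_lin (hG : MarkoffTrace G) {α β γ δ : ℤ}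
    (h : α * δ - β * γ = 1 ∨ α * δ - β * γ = -1)
    {x y z : ℝ} (hx : G (β, δ) = x) (hy : G (α + β, γ + δ) = y) (hz : G (α, γ) = z)
    (x0 : 0 < x) (y0 : 0 < y) (z0 : 0 < z) (hm : x ^ 2 + y ^ 2 + z ^ 2 = x * y * z) :
    MarkoffTrace (G ∘ lin α β γ δ) := by
  have e1 : (G ∘ lin α β γ δ) (0, 1) = x := by simp [lin, hx]
  have e2 : (G ∘ lin α β γ δ) (1, 1) = y := by simp [lin, hy]
  have e3 : (G ∘ lin α β γ δ) (1, 0) = z := by simp [lin, hz]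
  constructor
  · intro v hv
    have : lin α β γ δ (-v) = -lin α β γ δ v := by
      ext <;> simp [lin] <;> ring
    simp only [Function.comp_apply, this]
    exact hG.neg_eq _ (primitive_lin h hv)
  · intro v w hv hw hd
    have ea : lin α β γ δ (v + w) = lin α β γ δ v + lin α β γ δ w := by
      ext <;> simp [lin] <;> ring
    have es : lin α β γ δ (v - w) = lin α β γ δ v - lin α β γ δ w := by
      ext <;> simp [lin] <;> ring
    simp only [Function.comp_apply, ea, es]
    refine hG.add_rule _ _ (primitive_lin h hv) (primitive_lin h hw) ?_
    have : (lin α β γ δ v).1 * (lin α β γ δ w).2 - (lin α β γ δ v).2 * (lin α β γ δ w).1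
        = (α * δ - β * γ) * (v.1 * w.2 - v.2 * w.1) := by
      simp only [lin]; ring
    rw [this]
    rcases h with h | h <;> rcases hd with hd | hd <;> rw [h, hd] <;> norm_num
  · rw [e1]; exact two_lt_of_markoff y0 z0 x0 (by linarith)
  · rw [e2]; exact two_lt_of_markoff x0 z0 y0 (by linarith)
  · rw [e3]; exact two_lt_of_markoff x0 y0 z0 (by linarith)
  · rw [e1, e2, e3]; exact hm

lemma apply_21 (hG : MarkoffTrace G) : G (2, 1) = G (1, 1) * G (1, 0) - G (0, 1) := by
  simpa using hG.add_rule (1, 1) (1, 0) (isCoprime_one_left) (isCoprime_one_left) (by norm_num)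

lemma apply_12 (hG : MarkoffTrace G) : G (1, 2) = G (0, 1) * G (1, 1) - G (1, 0) := by
  have h := hG.add_rule (1, 1) (0, 1) (isCoprime_one_left) (isCoprime_one_right) (by norm_num)
  have e : ((1 : ℤ), (1 : ℤ)) + (0, 1) = (1, 2) := by norm_num
  have e' : ((1 : ℤ), (1 : ℤ)) - (0, 1) = (1, 0) := by norm_num
  rw [e, e'] at h
  linarith

lemma apply_neg11 (hG : MarkoffTrace G) : G (-1, 1) = G (0, 1) * G (1, 0) - G (1, 1) := by
  have h := hG.add_rule (0, 1) (1, 0) (isCoprime_one_right) (isCoprime_one_left) (by norm_num)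
  simp only [Prod.mk_add_mk, Prod.mk_sub_mk] at h
  norm_num at h
  linarith

lemma left (hG : MarkoffTrace G) : MarkoffTrace (G ∘ lin 1 1 0 1) := by
  have ha := hG.two_lt_01
  have hb := hG.two_lt_11
  have hc := hG.two_lt_10
  have hm := hG.markoff
  refine hG.comp_lin (by norm_num) rfl hG.apply_21 rfl (by linarith) ?_ (by linarith) ?_
  · refine pos_of_mul_pos_right (a := G (0, 1)) ?_ (by linarith)
    nlinarith
  · nlinarith

lemma right (hG : MarkoffTrace G) : MarkoffTrace (G ∘ lin 1 0 1 1) := by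
  have ha := hG.two_lt_01
  have hb := hG.two_lt_11
  have hc := hG.two_lt_10
  have hm := hG.markoff
  refine hG.comp_lin (by norm_num) rfl hG.apply_12 rfl (by linarith) ?_ (by linarith) ?_
  · refine pos_of_mul_pos_right (a := G (1, 0)) ?_ (by linarith)
    nlinarith
  · nlinarith

lemma reflect (hG : MarkoffTrace G) : MarkoffTrace (G ∘ lin (-1) 0 0 1) := by
  have ha := hG.two_lt_01
  have hb := hG.two_lt_11
  have hc := hG.two_lt_10
  have hm := hG.markoff
  refine hG.comp_lin (by norm_num) rfl hG.apply_neg11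
    (hG.neg_eq (1, 0) isCoprime_one_left) (by linarith) ?_ (by linarith) ?_
  · refine pos_of_mul_pos_right (a := G (1, 1)) ?_ (by linarith)
    nlinarith
  · nlinarith

end MarkoffTrace

/-- The coprime pairs of positive integers. -/
def posCoprime : Set (ℤ × ℤ) := {v | 0 < v.1 ∧ 0 < v.2 ∧ IsCoprime v.1 v.2}

lemma lin_left_mem {v : ℤ × ℤ} (hv : v ∈ posCoprime) : lin 1 1 0 1 v ∈ posCoprime := by
  obtain ⟨h1, h2, h3⟩ := hv
  exact ⟨by simp [lin]; linarith, by simp [lin, h2], primitive_lin (by norm_num) h3⟩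

lemma lin_right_mem {v : ℤ × ℤ} (hv : v ∈ posCoprime) : lin 1 0 1 1 v ∈ posCoprime := by
  obtain ⟨h1, h2, h3⟩ := hv
  exact ⟨by simp [lin, h1], by simp [lin]; linarith, primitive_lin (by norm_num) h3⟩

lemma lin_left_injective : Function.Injective (lin 1 1 0 1) := by
  rintro ⟨p, q⟩ ⟨r, s⟩ h
  simp only [lin, Prod.mk.injEq] at h ⊢
  constructor <;> linarith

lemma lin_right_injective : Function.Injective (lin 1 0 1 1) := by
  rintro ⟨p, q⟩ ⟨r, s⟩ h
  simp only [lin, Prod.mk.injEq] at h ⊢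
  constructor <;> linarith

lemma lin_reflect_injective : Function.Injective (lin (-1) 0 0 1) := by
  rintro ⟨p, q⟩ ⟨r, s⟩ h
  simp only [lin, Prod.mk.injEq] at h ⊢
  constructor <;> linarith

lemma mem_posCoprime_cases {v : ℤ × ℤ} (hv : v ∈ posCoprime) :
    v = (1, 1) ∨ (∃ w ∈ posCoprime, lin 1 1 0 1 w = v) ∨
      (∃ w ∈ posCoprime, lin 1 0 1 1 w = v) := by
  obtain ⟨p, q⟩ := v
  obtain ⟨h1, h2, h3⟩ := hv
  dsimp only at h1 h2 h3
  rcases lt_trichotomy p q with h | h | h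
  · refine Or.inr (Or.inr ⟨(p, q - p), ⟨h1, by simpa using h, ?_⟩, by simp [lin]⟩)
    obtain ⟨u, t, hut⟩ := h3
    exact ⟨u + t, t, by linear_combination hut⟩
  · subst h
    have : IsUnit p := isCoprime_self.1 h3
    rw [Int.isUnit_iff] at this
    left
    rcases this with rfl | rfl
    · rfl
    · omega
  · refine Or.inr (Or.inl ⟨(p - q, q), ⟨by simpa using h, h2, ?_⟩, by simp [lin]⟩)
    obtain ⟨u, t, hut⟩ := h3
    exact ⟨u, t + u, by linear_combination hut⟩

lemma posCoprime_eq :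
    posCoprime = ({(1, 1)} ∪ lin 1 1 0 1 '' posCoprime) ∪ lin 1 0 1 1 '' posCoprime := by
  ext v
  constructor
  · intro hv
    rcases mem_posCoprime_cases hv with h | h | h
    · exact Or.inl (Or.inl h)
    · exact Or.inl (Or.inr h)
    · exact Or.inr h
  · rintro ((h | ⟨w, hw, rfl⟩) | ⟨w, hw, rfl⟩)
    · rw [mem_singleton_iff.1 h]
      exact ⟨one_pos, one_pos, isCoprime_one_left⟩
    · exact lin_left_mem hw
    · exact lin_right_mem hw

lemma hasSum_image {s : Set (ℤ × ℤ)} {M : ℤ × ℤ → ℤ × ℤ} (hM : Function.Injective M)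
    {g : ℤ × ℤ → ℝ} {r : ℝ} (h : HasSum (fun v : s => g (M v)) r) :
    HasSum (fun v : M '' s => g v) r :=
  (Equiv.hasSum_iff (Equiv.Set.image M s hM) (f := fun v : M '' s => g v)).1 h

lemma hasSum_posCoprime {g : ℤ × ℤ → ℝ} {r s : ℝ}
    (hr : HasSum (fun v : posCoprime => g (lin 1 1 0 1 v)) r)
    (hs : HasSum (fun v : posCoprime => g (lin 1 0 1 1 v)) s) :
    HasSum (fun v : posCoprime => g v) (g (1, 1) + r + s) := by
  rw [posCoprime_eq]
  refine HasSum.add_disjoint ?_ (HasSum.add_disjoint ?_ (hasSum_singleton _ g)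
    (hasSum_image lin_left_injective hr)) (hasSum_image lin_right_injective hs)
  · rw [Set.disjoint_left]
    rintro _ (h | ⟨⟨p, q⟩, hw, rfl⟩) ⟨⟨p', q'⟩, ⟨h1, h2, -⟩, h'⟩
    · rw [mem_singleton_iff.1 h] at h'
      simp only [lin, Prod.mk.injEq] at h' h1 h2
      omega
    · obtain ⟨h3, h4, -⟩ := hw
      simp only [lin, Prod.mk.injEq] at h' h1 h2 h3 h4
      omega
  · rw [Set.disjoint_left]
    rintro _ h ⟨⟨p', q'⟩, ⟨h1, h2, -⟩, h'⟩
    rw [mem_singleton_iff.1 h] at h'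
    simp only [lin, Prod.mk.injEq] at h' h1 h2
    omega

open Classical in
/-- The coprime pairs of positive integers with coordinate sum at most `k`. -/
noncomputable def posCoprimeLE (k : ℕ) : Finset (ℤ × ℤ) :=
  (Finset.Icc 1 (k : ℤ) ×ˢ Finset.Icc 1 (k : ℤ)).filter
    (fun v => v ∈ posCoprime ∧ v.1 + v.2 ≤ k)

lemma mem_posCoprimeLE {k : ℕ} {v : ℤ × ℤ} :
    v ∈ posCoprimeLE k ↔ v ∈ posCoprime ∧ v.1 + v.2 ≤ k := by
  simp only [posCoprimeLE, Finset.mem_filter, Finset.mem_product, Finset.mem_Icc,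
    and_iff_right_iff_imp]
  rintro ⟨⟨h1, h2, -⟩, h3⟩
  omega

open Classical in
lemma sum_posCoprimeLE_succ_le {g : ℤ × ℤ → ℝ} (hg : ∀ v, 0 ≤ g v) (k : ℕ) :
    ∑ v ∈ posCoprimeLE (k + 1), g v ≤ g (1, 1) + ∑ v ∈ posCoprimeLE k, g (lin 1 1 0 1 v)
      + ∑ v ∈ posCoprimeLE k, g (lin 1 0 1 1 v) := by
  have hsub : posCoprimeLE (k + 1) ⊆ ({(1, 1)} ∪ (posCoprimeLE k).image (lin 1 1 0 1)) ∪
      (posCoprimeLE k).image (lin 1 0 1 1) := by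
    intro v hv
    obtain ⟨hv, hk⟩ := mem_posCoprimeLE.1 hv
    simp only [Finset.mem_union, Finset.mem_singleton, Finset.mem_image]
    rcases mem_posCoprime_cases hv with h | ⟨w, hw, rfl⟩ | ⟨w, hw, rfl⟩
    · exact Or.inl (Or.inl h)
    · refine Or.inl (Or.inr ⟨w, mem_posCoprimeLE.2 ⟨hw, ?_⟩, rfl⟩)
      have := hw.2.1
      simp only [lin] at hk
      push_cast at hk
      linarith
    · refine Or.inr ⟨w, mem_posCoprimeLE.2 ⟨hw, ?_⟩, rfl⟩
      have := hw.1
      simp only [lin] at hk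
      push_cast at hk
      linarith
  have hunion : ∀ s t : Finset (ℤ × ℤ), ∑ v ∈ s ∪ t, g v ≤ ∑ v ∈ s, g v + ∑ v ∈ t, g v := by
    intro s t
    rw [← Finset.sum_union_inter]
    have := Finset.sum_nonneg (s := s ∩ t) (fun v _ => hg v)
    linarith
  calc _ ≤ _ := Finset.sum_le_sum_of_subset_of_nonneg hsub (fun v _ _ => hg v)
    _ ≤ _ := (hunion _ _).trans (add_le_add_left (hunion _ _) _)
    _ = _ := by
      rw [Finset.sum_singleton, Finset.sum_image lin_left_injective.injOn,
        Finset.sum_image lin_right_injective.injOn]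

/-- The share `z / (x y)` of the edge separating `(1,0)` and `(0,1)`, directed towards `(1,1)`. -/
noncomputable def share (G : ℤ × ℤ → ℝ) : ℝ := 1 - G (1, 1) / (G (0, 1) * G (1, 0))

/-- The trace grows across the edge separating `(1,0)` and `(0,1)` towards `(1,1)`. -/
def Growing (G : ℤ × ℤ → ℝ) : Prop := G (0, 1) * G (1, 0) ≤ 2 * G (1, 1)

/-- The relative form of McShane's identity, for the traces beyond an edge. -/
def EdgeIdentity (G : ℤ × ℤ → ℝ) : Prop :=
  HasSum (fun v : posCoprime => gap (G v)) ((share G - gap (G (0, 1)) - gap (G (1, 0))) / 2)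

namespace MarkoffTrace

variable {G : ℤ × ℤ → ℝ}

lemma left_01 : (G ∘ lin 1 1 0 1) (0, 1) = G (1, 1) := rfl

lemma left_10 : (G ∘ lin 1 1 0 1) (1, 0) = G (1, 0) := rfl

lemma left_11 (hG : MarkoffTrace G) :
    (G ∘ lin 1 1 0 1) (1, 1) = G (1, 1) * G (1, 0) - G (0, 1) := hG.apply_21

lemma right_01 : (G ∘ lin 1 0 1 1) (0, 1) = G (0, 1) := rfl

lemma right_10 : (G ∘ lin 1 0 1 1) (1, 0) = G (1, 1) := rfl

lemma right_11 (hG : MarkoffTrace G) :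
    (G ∘ lin 1 0 1 1) (1, 1) = G (0, 1) * G (1, 1) - G (1, 0) := hG.apply_12

lemma share_eq (hG : MarkoffTrace G) :
    share G = share (G ∘ lin 1 1 0 1) + share (G ∘ lin 1 0 1 1) := by
  have ha := hG.two_lt_01
  have hb := hG.two_lt_11
  have hc := hG.two_lt_10
  have hm := hG.markoff
  rw [share, share, share, left_01, left_10, hG.left_11, right_01, right_10, hG.right_11]
  have : G (0, 1) ≠ 0 := by positivity
  have : G (1, 1) ≠ 0 := by positivity
  have : G (1, 0) ≠ 0 := by positivity
  field_simp
  linear_combination -hm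

lemma share_mul_one_sub (hG : MarkoffTrace G) : share G * (1 - share G)
    = gap (G (0, 1)) * (1 - gap (G (0, 1))) + gap (G (1, 0)) * (1 - gap (G (1, 0))) := by
  have ha := hG.two_lt_01
  have hc := hG.two_lt_10
  have hm := hG.markoff
  rw [gap_mul_one_sub ha, gap_mul_one_sub hc, share]
  have : G (0, 1) ≠ 0 := by positivity
  have : G (1, 0) ≠ 0 := by positivity
  field_simp
  linear_combination -hm

lemma share_le_half (hG : MarkoffTrace G) (hg : Growing G) : share G ≤ 1 / 2 := by
  have ha := hG.two_lt_01
  have hc := hG.two_lt_10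
  have : 1 / 2 ≤ G (1, 1) / (G (0, 1) * G (1, 0)) := by
    rw [le_div_iff₀ (by positivity)]
    unfold Growing at hg; linarith
  unfold share; linarith

lemma gap_add_gap_le (hG : MarkoffTrace G) :
    gap (G (0, 1)) + gap (G (1, 0)) ≤ share G :=
  add_le_of_mul_one_sub_eq (gap_nonneg _) (gap_nonneg _) (gap_le_half _) (gap_le_half _)
    hG.share_mul_one_sub

lemma growing_left (hG : MarkoffTrace G) (hg : Growing G) : Growing (G ∘ lin 1 1 0 1) := by
  have ha := hG.two_lt_01
  have hc := hG.two_lt_10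
  rw [Growing, left_01, left_10, hG.left_11]
  unfold Growing at hg
  nlinarith [mul_le_mul_of_nonneg_right hg (show 0 ≤ G (1, 0) by linarith),
    mul_pos (show 0 < G (0, 1) by linarith) (show 0 < G (1, 0) ^ 2 - 4 by nlinarith)]

lemma growing_right (hG : MarkoffTrace G) (hg : Growing G) : Growing (G ∘ lin 1 0 1 1) := by
  have ha := hG.two_lt_01
  have hc := hG.two_lt_10
  rw [Growing, right_01, right_10, hG.right_11]
  unfold Growing at hg
  nlinarith [mul_le_mul_of_nonneg_right hg (show 0 ≤ G (0, 1) by linarith),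
    mul_pos (show 0 < G (1, 0) by linarith) (show 0 < G (0, 1) ^ 2 - 4 by nlinarith)]

lemma le_left_11 (hG : MarkoffTrace G) (hg : Growing G) :
    G (1, 1) ≤ (G ∘ lin 1 1 0 1) (1, 1) := by
  have h := hG.growing_left hg
  rw [Growing, left_01, left_10] at h
  nlinarith [hG.two_lt_10, hG.two_lt_11]

lemma le_right_11 (hG : MarkoffTrace G) (hg : Growing G) :
    G (1, 1) ≤ (G ∘ lin 1 0 1 1) (1, 1) := by
  have h := hG.growing_right hg
  rw [Growing, right_01, right_10] at h
  nlinarith [hG.two_lt_01, hG.two_lt_11]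

lemma sum_posCoprimeLE_le (k : ℕ) : ∀ {G : ℤ × ℤ → ℝ}, MarkoffTrace G → Growing G →
    gap (G (0, 1)) + gap (G (1, 0)) + 2 * ∑ v ∈ posCoprimeLE k, gap (G v) ≤ share G := by
  induction k with
  | zero =>
    intro G hG hg
    have : posCoprimeLE 0 = ∅ := by
      ext v
      simp only [mem_posCoprimeLE, Finset.notMem_empty, iff_false]
      rintro ⟨⟨h1, h2, -⟩, h3⟩
      push_cast at h3
      omega
    simpa [this] using hG.gap_add_gap_le
  | succ k ih =>
    intro G hG hg
    have h := sum_posCoprimeLE_succ_le (g := fun v => gap (G v)) (fun v => gap_nonneg _) k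
    have h1 := ih hG.left (hG.growing_left hg)
    have h2 := ih hG.right (hG.growing_right hg)
    rw [left_01, left_10] at h1
    rw [right_01, right_10] at h2
    simp only [Function.comp_apply] at h1 h2
    rw [hG.share_eq]
    linarith

lemma sum_gap_le (hG : MarkoffTrace G) (hg : Growing G) (u : Finset posCoprime) :
    ∑ v ∈ u, gap (G v) ≤ (share G - gap (G (0, 1)) - gap (G (1, 0))) / 2 := by
  obtain ⟨k, hk⟩ : ∃ k : ℕ, ∀ v ∈ u, v.1.1 + v.1.2 ≤ (k : ℤ) := by
    refine ⟨∑ v ∈ u, (v.1.1 + v.1.2).toNat, fun v hv => ?_⟩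
    have := Finset.single_le_sum (f := fun v : posCoprime => (v.1.1 + v.1.2).toNat)
      (fun _ _ => Nat.zero_le _) hv
    omega
  have hle : ∑ v ∈ u, gap (G v) ≤ ∑ v ∈ posCoprimeLE k, gap (G v) := by
    have e := Finset.sum_map u (Function.Embedding.subtype _) (fun v => gap (G v))
    simp only [Function.Embedding.subtype_apply] at e
    rw [← e]
    refine Finset.sum_le_sum_of_subset_of_nonneg ?_ (fun v _ _ => gap_nonneg _)
    intro v hv
    obtain ⟨w, hw, rfl⟩ := Finset.mem_map.1 hv
    exact mem_posCoprimeLE.2 ⟨w.2, hk w hw⟩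
  have h := sum_posCoprimeLE_le k hG hg
  linarith

lemma summable_gap (hG : MarkoffTrace G) (hg : Growing G) :
    Summable (fun v : posCoprime => gap (G v)) :=
  summable_of_sum_le (fun _ => gap_nonneg _) (hG.sum_gap_le hg)

/-- The amount by which the relative McShane identity could fail at an edge. -/
noncomputable def deficit (G : ℤ × ℤ → ℝ) : ℝ :=
  share G - gap (G (0, 1)) - gap (G (1, 0)) - 2 * ∑' v : posCoprime, gap (G v)

lemma tsum_gap_eq (hG : MarkoffTrace G) (hg : Growing G) :
    ∑' v : posCoprime, gap (G v) = gap (G (1, 1))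
      + ∑' v : posCoprime, gap ((G ∘ lin 1 1 0 1) v)
      + ∑' v : posCoprime, gap ((G ∘ lin 1 0 1 1) v) :=
  (hasSum_posCoprime (g := fun v => gap (G v))
    (hG.left.summable_gap (hG.growing_left hg)).hasSum
    (hG.right.summable_gap (hG.growing_right hg)).hasSum).tsum_eq

lemma deficit_eq (hG : MarkoffTrace G) (hg : Growing G) :
    deficit G = deficit (G ∘ lin 1 1 0 1) + deficit (G ∘ lin 1 0 1 1) := by
  unfold deficit
  rw [hG.tsum_gap_eq hg, hG.share_eq, left_01, left_10, right_01, right_10]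
  ring

lemma mul_deficit_left_le (hG : MarkoffTrace G) (hg : Growing G) {m : ℝ} (hm : 2 < m)
    (hc : m ≤ G (1, 0)) : (1 / 2 - gap m) * deficit G ≤ gap (G (0, 1)) := by
  have h := mul_sub_le_of_mul_one_sub_eq (gap_nonneg (G (0, 1)))
    (by linarith [hG.gap_add_gap_le]) (hG.share_le_half hg)
    (sub_le_sub_left (gap_anti hm hc) (1 / 2)) (by linarith [hG.share_mul_one_sub])
  refine le_trans (mul_le_mul_of_nonneg_left ?_ (sub_pos.2 (gap_lt_half hm)).le) h
  have : 0 ≤ ∑' v : posCoprime, gap (G v) := tsum_nonneg fun _ => gap_nonneg _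
  unfold deficit
  linarith [gap_nonneg (G (0, 1))]

lemma mul_deficit_right_le (hG : MarkoffTrace G) (hg : Growing G) {m : ℝ} (hm : 2 < m)
    (ha : m ≤ G (0, 1)) : (1 / 2 - gap m) * deficit G ≤ gap (G (1, 0)) := by
  have h := mul_sub_le_of_mul_one_sub_eq (gap_nonneg (G (1, 0)))
    hG.gap_add_gap_le (hG.share_le_half hg)
    (sub_le_sub_left (gap_anti hm ha) (1 / 2)) hG.share_mul_one_sub
  refine le_trans (mul_le_mul_of_nonneg_left ?_ (sub_pos.2 (gap_lt_half hm)).le) h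
  have : 0 ≤ ∑' v : posCoprime, gap (G v) := tsum_nonneg fun _ => gap_nonneg _
  unfold deficit
  linarith [gap_nonneg (G (1, 0))]

lemma nat_mul_deficit_le {m : ℝ} (hm : 2 < m) (n : ℕ) : ∀ {G : ℤ × ℤ → ℝ}, MarkoffTrace G →
    Growing G → m ≤ G (0, 1) → m ≤ G (1, 1) → m ≤ G (1, 0) →
    n * ((1 / 2 - gap m) * deficit G) ≤ 2 * ∑' v : posCoprime, gap (G v) := by
  induction n with
  | zero =>
    intro G _ _ _ _ _
    have : 0 ≤ ∑' v : posCoprime, gap (G v) := tsum_nonneg fun _ => gap_nonneg _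
    simpa using this
  | succ n ih =>
    intro G hG hg ha hb hc
    have hl := hG.growing_left hg
    have hr := hG.growing_right hg
    have h1 := ih hG.left hl hb (hb.trans (hG.le_left_11 hg)) hc
    have h2 := ih hG.right hr ha (hb.trans (hG.le_right_11 hg)) hb
    have h3 := hG.left.mul_deficit_left_le hl hm hc
    have h4 := hG.right.mul_deficit_right_le hr hm ha
    rw [left_01] at h3
    rw [right_10] at h4
    rw [hG.tsum_gap_eq hg, hG.deficit_eq hg]
    push_cast
    linarith

lemma deficit_nonpos (hG : MarkoffTrace G) (hg : Growing G) : deficit G ≤ 0 := by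
  by_contra! hd
  have hm : 2 < min (G (0, 1)) (min (G (1, 1)) (G (1, 0))) :=
    lt_min hG.two_lt_01 (lt_min hG.two_lt_11 hG.two_lt_10)
  have hpos := mul_pos (sub_pos.2 (gap_lt_half hm)) hd
  obtain ⟨n, hn⟩ := exists_nat_gt ((2 * ∑' v : posCoprime, gap (G v)) /
    ((1 / 2 - gap (min (G (0, 1)) (min (G (1, 1)) (G (1, 0))))) * deficit G))
  rw [div_lt_iff₀ hpos] at hn
  exact absurd (nat_mul_deficit_le hm n hG hg (min_le_left _ _)
    ((min_le_right _ _).trans (min_le_left _ _))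
    ((min_le_right _ _).trans (min_le_right _ _))) (not_le.2 hn)

lemma edgeIdentity_of_growing (hG : MarkoffTrace G) (hg : Growing G) : EdgeIdentity G := by
  have hs := hG.summable_gap hg
  have hle := hs.tsum_le_of_sum_le (hG.sum_gap_le hg)
  have hge := hG.deficit_nonpos hg
  unfold deficit at hge
  have : ∑' v : posCoprime, gap (G v) = (share G - gap (G (0, 1)) - gap (G (1, 0))) / 2 :=
    le_antisymm hle (by linarith)
  rw [EdgeIdentity, ← this]
  exact hs.hasSum

lemma edgeIdentity_of_children (hG : MarkoffTrace G) (hl : EdgeIdentity (G ∘ lin 1 1 0 1))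
    (hr : EdgeIdentity (G ∘ lin 1 0 1 1)) : EdgeIdentity G := by
  have h := hasSum_posCoprime (g := fun v => gap (G v)) hl hr
  rw [left_01, left_10, right_01, right_10] at h
  rw [EdgeIdentity, hG.share_eq]
  convert h using 1
  ring

lemma growing_left_of_lt (hG : MarkoffTrace G) {M : ℝ} (ha : G (0, 1) ≤ M)
    (h : G (0, 1) * G (1, 0) - 2 * G (1, 1) < 8 / M) : Growing (G ∘ lin 1 1 0 1) := by
  have ha2 := hG.two_lt_01
  have hc2 := hG.two_lt_10
  have hm := hG.markoff
  rw [Growing, left_01, left_10, hG.left_11]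
  have h8 : G (0, 1) * (G (0, 1) * G (1, 0) - 2 * G (1, 1)) < 8 := by
    rw [lt_div_iff₀ (by linarith)] at h
    by_contra! h'
    have : 0 < G (0, 1) * G (1, 0) - 2 * G (1, 1) := by
      by_contra! h0
      nlinarith
    nlinarith
  have key : 4 * G (1, 0) ^ 2 ≤ G (0, 1) ^ 2 * (G (1, 0) ^ 2 - 4) := by
    nlinarith [sq_nonneg (G (0, 1) * G (1, 0) - 2 * G (1, 1))]
  have : 0 ≤ G (0, 1) * (2 * (G (1, 1) * G (1, 0) - G (0, 1)) - G (1, 1) * G (1, 0)) := by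
    nlinarith [mul_lt_mul_of_pos_right h8 (show 0 < G (1, 0) by linarith)]
  have := nonneg_of_mul_nonneg_right this (by linarith)
  linarith

lemma growing_right_of_lt (hG : MarkoffTrace G) {M : ℝ} (hc : G (1, 0) ≤ M)
    (h : G (0, 1) * G (1, 0) - 2 * G (1, 1) < 8 / M) : Growing (G ∘ lin 1 0 1 1) := by
  have ha2 := hG.two_lt_01
  have hc2 := hG.two_lt_10
  have hm := hG.markoff
  rw [Growing, right_01, right_10, hG.right_11]
  have h8 : G (1, 0) * (G (0, 1) * G (1, 0) - 2 * G (1, 1)) < 8 := by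
    rw [lt_div_iff₀ (by linarith)] at h
    by_contra! h'
    have : 0 < G (0, 1) * G (1, 0) - 2 * G (1, 1) := by
      by_contra! h0
      nlinarith
    nlinarith
  have key : 4 * G (0, 1) ^ 2 ≤ G (1, 0) ^ 2 * (G (0, 1) ^ 2 - 4) := by
    nlinarith [sq_nonneg (G (0, 1) * G (1, 0) - 2 * G (1, 1))]
  have : 0 ≤ G (1, 0) * (2 * (G (0, 1) * G (1, 1) - G (1, 0)) - G (0, 1) * G (1, 1)) := by
    nlinarith [mul_lt_mul_of_pos_right h8 (show 0 < G (0, 1) by linarith)]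
  have := nonneg_of_mul_nonneg_right this (by linarith)
  linarith

/-- Descent towards the smallest Markoff triple takes finitely many steps. -/
lemma edgeIdentity_of_le {M : ℝ} (n : ℕ) : ∀ {G : ℤ × ℤ → ℝ}, MarkoffTrace G →
    G (0, 1) ≤ M → G (1, 0) ≤ M → G (0, 1) * G (1, 0) - G (1, 1) ≤ M →
    G (0, 1) + G (1, 0) + (G (0, 1) * G (1, 0) - G (1, 1)) ≤ n * (8 / M) →
    EdgeIdentity G := by
  induction n with
  | zero =>
    intro G hG _ _ _ h
    have h1 := hG.reflect.two_lt_11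
    have e : (G ∘ lin (-1) 0 0 1) (1, 1) = G (-1, 1) := rfl
    rw [e, hG.apply_neg11] at h1
    rw [Nat.cast_zero, zero_mul] at h
    linarith [hG.two_lt_01, hG.two_lt_10]
  | succ n ih =>
    intro G hG ha hc hz h
    by_cases hg : Growing G
    · exact hG.edgeIdentity_of_growing hg
    · rw [Growing, not_le] at hg
      push_cast at h
      rcases lt_or_ge (G (0, 1) * G (1, 0) - 2 * G (1, 1)) (8 / M) with hlt | hge
      · exact hG.edgeIdentity_of_children
          (hG.left.edgeIdentity_of_growing (hG.growing_left_of_lt ha hlt))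
          (hG.right.edgeIdentity_of_growing (hG.growing_right_of_lt hc hlt))
      · refine hG.edgeIdentity_of_children (ih hG.left ?_ ?_ ?_ ?_) (ih hG.right ?_ ?_ ?_ ?_) <;>
          simp only [left_01, left_10, hG.left_11, right_01, right_10, hG.right_11] <;> linarith

lemma edgeIdentity (hG : MarkoffTrace G) : EdgeIdentity G := by
  obtain ⟨M, hM⟩ : ∃ M, M = G (0, 1) + G (1, 0) + (G (0, 1) * G (1, 0) - G (1, 1)) := ⟨_, rfl⟩
  have h1 := hG.reflect.two_lt_11
  have e : (G ∘ lin (-1) 0 0 1) (1, 1) = G (-1, 1) := rfl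
  rw [e, hG.apply_neg11] at h1
  have ha := hG.two_lt_01
  have hc := hG.two_lt_10
  have hMpos : 0 < M := by linarith
  obtain ⟨n, hn⟩ := exists_nat_gt (M / (8 / M))
  rw [div_lt_iff₀ (by positivity)] at hn
  exact edgeIdentity_of_le (M := M) n hG (by linarith) (by linarith) (by linarith) (by linarith)

end MarkoffTrace

lemma primitive_representatives_eq :
    {v : ℤ × ℤ | IsCoprime v.1 v.2 ∧ (0 < v.2 ∨ v = (1, 0))} =
      (({(0, 1)} ∪ {(1, 0)}) ∪ posCoprime) ∪ lin (-1) 0 0 1 '' posCoprime := by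
  ext ⟨p, q⟩
  simp only [mem_ofPred_eq, mem_union, mem_singleton_iff]
  constructor
  · rintro ⟨h, hq | hq⟩
    · rcases lt_trichotomy p 0 with hp | rfl | hp
      · exact Or.inr ⟨(-p, q), ⟨by simpa using hp, hq, h.neg_left⟩, by simp [lin]⟩
      · rw [isCoprime_zero_left, Int.isUnit_iff] at h
        left; left; left
        rcases h with rfl | rfl
        · rfl
        · omega
      · exact Or.inl (Or.inr ⟨hp, hq, h⟩)
    · exact Or.inl (Or.inl (Or.inr hq))
  · rintro (((h | h) | h) | ⟨w, hw, h⟩)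
    · rw [Prod.mk.injEq] at h
      rw [h.1, h.2]
      exact ⟨isCoprime_one_right, Or.inl one_pos⟩
    · rw [Prod.mk.injEq] at h
      rw [h.1, h.2]
      exact ⟨isCoprime_one_left, Or.inr rfl⟩
    · exact ⟨h.2.2, Or.inl h.2.1⟩
    · have := primitive_lin (α := -1) (β := 0) (γ := 0) (δ := 1) (by norm_num) hw.2.2
      rw [h] at this
      refine ⟨this, Or.inl ?_⟩
      have h2 := hw.2.1
      simp only [lin, Prod.mk.injEq] at h
      linarith [h.2]

lemma hasSum_primitive_representatives {g : ℤ × ℤ → ℝ} {r s : ℝ}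
    (hr : HasSum (fun v : posCoprime => g v) r)
    (hs : HasSum (fun v : posCoprime => g (lin (-1) 0 0 1 v)) s) :
    HasSum (fun v : {v : ℤ × ℤ | IsCoprime v.1 v.2 ∧ (0 < v.2 ∨ v = (1, 0))} => g v)
      (g (0, 1) + g (1, 0) + r + s) := by
  rw [primitive_representatives_eq]
  refine HasSum.add_disjoint ?_ (HasSum.add_disjoint ?_ (HasSum.add_disjoint ?_
    (hasSum_singleton _ g) (hasSum_singleton _ g)) hr) (hasSum_image lin_reflect_injective hs)
  · rw [Set.disjoint_left]
    rintro _ h ⟨⟨p, q⟩, ⟨h1, h2, -⟩, rfl⟩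
    simp only [mem_union, mem_singleton_iff, lin, posCoprime, mem_ofPred_eq, Prod.mk.injEq]
      at h h1 h2
    omega
  · rw [Set.disjoint_left]
    rintro _ (h | h) ⟨h1, h2, -⟩ <;> rw [mem_singleton_iff.1 h] at h1 h2 <;> simp at h1 h2
  · simp

end McShane

/-- McShane's identity in trace coordinates: for a Markoff triple of reals `(a,b,c)`
with trace function `T`, the sum over all primitive vectors up to sign (coprime pairs
`(p,q)` with `q > 0`, together with `(1,0)`) of `(1 − √(1 − 4/T(p,q)²))/2` converges
to `1/2`. -/
theorem mcshane_identity (a b c : ℝ) (ha : 2 < a) (hb : 2 < b) (hc : 2 < c)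
    (habc : a ^ 2 + b ^ 2 + c ^ 2 = a * b * c)
    (T : ℤ × ℤ → ℝ) (hT : IsTraceFunction a b c T) :
    HasSum
      (fun v : {v : ℤ × ℤ // IsCoprime v.1 v.2 ∧ (0 < v.2 ∨ v = (1, 0))} =>
        (1 - Real.sqrt (1 - 4 / T v.val ^ 2)) / 2)
      (1 / 2) := by
  have hG : McShane.MarkoffTrace T := by
    refine ⟨hT.neg_eq, hT.add_rule, ?_, ?_, ?_, ?_⟩ <;>
      simp only [hT.map_01, hT.map_11, hT.map_10] <;> assumption
  have h1 := hG.edgeIdentity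
  have h2 := hG.reflect.edgeIdentity
  have h := McShane.hasSum_primitive_representatives (g := fun v => McShane.gap (T v)) h1 h2
  have e01 : (T ∘ McShane.lin (-1) 0 0 1) (0, 1) = a := hT.map_01
  have e10 : (T ∘ McShane.lin (-1) 0 0 1) (1, 0) = c :=
    (hT.neg_eq (1, 0) isCoprime_one_left).trans hT.map_10
  have e11 : (T ∘ McShane.lin (-1) 0 0 1) (1, 1) = a * c - b := by
    rw [← hT.map_01, ← hT.map_10, ← hT.map_11]
    exact hG.apply_neg11
  refine (congrArg (HasSum _) ?_).mp h
  simp only [McShane.share, e01, e10, e11, hT.map_01, hT.map_10, hT.map_11]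
  have ha0 : a ≠ 0 := by positivity
  have hc0 : c ≠ 0 := by positivity
  field_simp
  ring
end
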